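/- Let (C_n) and (C'_n) be sequences where C_n and C'_n are conjugacy classes of S_n, with cycle counts c_j(n) and c'_j(n). For π ∈ C_n and π' ∈ C'_n chosen uniformly and independently, let N = N_n(π, π') be the number of orbits of the subgroup ⟨π, π'⟩ on {1,…,n} that have size at most n/2. Assume c_1(n) + c'_1(n) = o(n^{2/3}), (c_1(n) + c_2(n)^{1/2})(c'_1(n) + c'_2(n)^{1/2}) = O(n), and limsup_{n→∞} (c_2(n) + c'_2(n))/n < 1. Then P(N_n = 0) − exp(−E[N_n]) → 0 as n → ∞. -/

import Mathlib

open Filter Asymptotics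

/-- The number of `j`-cycles in the cycle decomposition of `π` (fixed points are `1`-cycles). -/
noncomputable def cycleCount {n : ℕ} (π : Equiv.Perm (Fin n)) (j : ℕ) : ℕ :=
  if j = 1 then Nat.card (Function.fixedPoints ⇑π) else Multiset.count j π.cycleType

/-- The number of orbits of `⟨a, b⟩` on `{1, …, n}` of size at most `n/2`. -/
noncomputable def smallOrbitCount {n : ℕ} (a b : Equiv.Perm (Fin n)) : ℕ :=
  Nat.card {X : Set (Fin n) //
    (∃ x : Fin n, X = MulAction.orbit (Subgroup.closure {a, b}) x) ∧ 2 * Nat.card X ≤ n}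

open scoped Classical in
/-- The expected number of orbits of size at most `n/2` of `⟨π₁, π₂⟩`, where `π₁, π₂` are
uniform and independent in the conjugacy classes of `π, π'` respectively. -/
noncomputable def expectedSmallOrbits (n : ℕ) (π π' : Equiv.Perm (Fin n)) : ℝ :=
  (∑ p : Equiv.Perm (Fin n) × Equiv.Perm (Fin n),
      if IsConj π p.1 ∧ IsConj π' p.2 then (smallOrbitCount p.1 p.2 : ℝ) else 0) /
  ((Nat.card {σ : Equiv.Perm (Fin n) // IsConj π σ} : ℝ) *
   (Nat.card {σ : Equiv.Perm (Fin n) // IsConj π' σ} : ℝ))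

/-- The probability that `⟨π₁, π₂⟩` has no orbit of size at most `n/2`, where `π₁, π₂` are
uniform and independent in the conjugacy classes of `π, π'` respectively. -/
noncomputable def probNoSmallOrbit (n : ℕ) (π π' : Equiv.Perm (Fin n)) : ℝ :=
  (Nat.card {p : Equiv.Perm (Fin n) × Equiv.Perm (Fin n) //
      IsConj π p.1 ∧ IsConj π' p.2 ∧ smallOrbitCount p.1 p.2 = 0} : ℝ) /
  ((Nat.card {σ : Equiv.Perm (Fin n) // IsConj π σ} : ℝ) *
   (Nat.card {σ : Equiv.Perm (Fin n) // IsConj π' σ} : ℝ))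

lemma succ_pow_le_exp_mul_pow (m : ℕ) :
    ((m : ℝ) + 1) ^ m ≤ Real.exp 1 * (m : ℝ) ^ m := by
  rcases Nat.eq_zero_or_pos m with rfl | hm
  · simp
  have hm' : (0 : ℝ) < m := by exact_mod_cast hm
  have h1 : ((m : ℝ) + 1) = (1 / m + 1) * m := by field_simp; ring
  have h2 : (1 / (m : ℝ) + 1) ^ m ≤ Real.exp 1 := by
    calc (1 / (m : ℝ) + 1) ^ m ≤ (Real.exp (1 / m)) ^ m := by
          gcongr; exact Real.add_one_le_exp _
      _ = Real.exp 1 := by rw [← Real.exp_nat_mul]; congr 1; field_simp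
  rw [h1, mul_pow]
  gcongr

lemma exp_mul_pow_le_succ_pow (m : ℕ) :
    Real.exp 1 * (m : ℝ) ^ (m + 1) ≤ ((m : ℝ) + 1) ^ (m + 1) := by
  have hp : (0 : ℝ) < (m : ℝ) + 1 := by positivity
  have h2 : (m : ℝ) ≤ Real.exp (-(1 / ((m : ℝ) + 1))) * ((m : ℝ) + 1) := by
    calc (m : ℝ) = (-(1 / ((m : ℝ) + 1)) + 1) * ((m : ℝ) + 1) := by field_simp; ring
      _ ≤ _ := by gcongr; exact Real.add_one_le_exp _
  calc Real.exp 1 * (m : ℝ) ^ (m + 1)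
      ≤ Real.exp 1 * (Real.exp (-(1 / ((m : ℝ) + 1))) * ((m : ℝ) + 1)) ^ (m + 1) := by gcongr
    _ = ((m : ℝ) + 1) ^ (m + 1) := by
        rw [mul_pow, ← Real.exp_nat_mul, ← mul_assoc, ← Real.exp_add]
        have : (1 : ℝ) + ((m + 1 : ℕ) : ℝ) * -(1 / ((m : ℝ) + 1)) = 0 := by
          push_cast; field_simp; ring
        rw [this]; simp

lemma monotone_factorial_mul_exp_div_pow :
    Monotone fun m : ℕ => (m.factorial : ℝ) * Real.exp m / (m : ℝ) ^ m := by
  refine monotone_nat_of_le_succ fun m => ?_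
  have hpos : (0 : ℝ) < (m : ℝ) ^ m := by
    rcases Nat.eq_zero_or_pos m with rfl | hm
    · simp
    · positivity
  rw [div_le_div_iff₀ hpos (by positivity), Nat.factorial_succ]
  push_cast
  rw [Real.exp_add, pow_succ]
  have := mul_le_mul_of_nonneg_left (succ_pow_le_exp_mul_pow m)
    (show 0 ≤ (m.factorial : ℝ) * Real.exp m * ((m : ℝ) + 1) by positivity)
  linarith

lemma factorial_mul_exp_le (k : ℕ) (hk : 1 ≤ k) :
    (k.factorial : ℝ) * Real.exp k ≤ Real.exp 1 * k * (k : ℝ) ^ k := by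
  induction k, hk using Nat.le_induction with
  | base => simp
  | succ m hm ih =>
    rw [Nat.factorial_succ]
    push_cast
    rw [Real.exp_add]
    have h1 := mul_le_mul_of_nonneg_left ih
      (show 0 ≤ ((m : ℝ) + 1) * Real.exp 1 by positivity)
    have h2 := mul_le_mul_of_nonneg_left (exp_mul_pow_le_succ_pow m)
      (show 0 ≤ ((m : ℝ) + 1) * Real.exp 1 by positivity)
    rw [pow_succ (m : ℝ)] at h2
    linarith

/-- An entropy lower bound for binomial coefficients, with polynomial loss in `k` only. -/
lemma pow_self_le_choose {n k : ℕ} (hk : 1 ≤ k) (hkn : k ≤ n) :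
    (n : ℝ) ^ n ≤ Real.exp 1 * k * (k : ℝ) ^ k * ((n - k : ℕ) : ℝ) ^ (n - k) * n.choose k := by
  have hmono := monotone_factorial_mul_exp_div_pow (Nat.sub_le n k)
  have hpos : ∀ m : ℕ, (0 : ℝ) < (m : ℝ) ^ m := fun m => by
    rcases Nat.eq_zero_or_pos m with rfl | hm
    · simp
    · positivity
  simp only at hmono
  rw [div_le_div_iff₀ (hpos _) (hpos _)] at hmono
  have hch : (n.choose k : ℝ) * k.factorial * (n - k).factorial = n.factorial := by
    exact_mod_cast Nat.choose_mul_factorial_mul_factorial hkn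
  have hexp : Real.exp n = Real.exp k * Real.exp (n - k : ℕ) := by
    rw [← Real.exp_add, Nat.cast_sub hkn]; congr 1; ring
  rw [← hch, hexp] at hmono
  have hX : (0 : ℝ) < (n - k).factorial * Real.exp (n - k : ℕ) := by positivity
  have h3 := factorial_mul_exp_le k hk
  have h4 := mul_le_mul_of_nonneg_left h3
    (show 0 ≤ (n.choose k : ℝ) * ((n - k : ℕ) : ℝ) ^ (n - k) by positivity)
  refine le_trans (le_of_mul_le_mul_left (a := (n - k).factorial * Real.exp (n - k : ℕ))
    (b := (n : ℝ) ^ n)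
    (c := n.choose k * ((n - k : ℕ) : ℝ) ^ (n - k) * (k.factorial * Real.exp k)) ?_ hX) ?_
  · linarith
  · linarith

lemma pow_le_choose {n k : ℕ} (hk : 1 ≤ k) (hkn : k ≤ n) :
    (n : ℝ) ^ k ≤ Real.exp 1 * k * (k : ℝ) ^ k * n.choose k := by
  have h := pow_self_le_choose hk hkn
  rcases Nat.eq_zero_or_pos (n - k) with h0 | h0
  · have : n = k := by omega
    subst this
    simpa using h
  have hp : (0 : ℝ) < ((n - k : ℕ) : ℝ) ^ (n - k) := by positivity
  have h1 : (n : ℝ) ^ k * ((n - k : ℕ) : ℝ) ^ (n - k) ≤ (n : ℝ) ^ n := by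
    calc (n : ℝ) ^ k * ((n - k : ℕ) : ℝ) ^ (n - k) ≤ (n : ℝ) ^ k * (n : ℝ) ^ (n - k) := by
          gcongr; exact Nat.sub_le n k
      _ = (n : ℝ) ^ n := by rw [← pow_add]; congr 1; omega
  refine le_of_mul_le_mul_right (a := ((n - k : ℕ) : ℝ) ^ (n - k)) ?_ hp
  linarith

/-- The value at `x` of the generating function `(1 + x) ^ a * (1 + x ^ 2) ^ b * (1 + x ^ 3) ^ d`,
which dominates that of the invariant sets of a permutation with `a` fixed points, `b` transpositions
and `d` longer cycles. -/
noncomputable def cycleGen (a b d : ℕ) (x : ℝ) : ℝ :=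
  (1 + x) ^ a * (1 + x ^ 2) ^ b * (1 + x ^ 3) ^ d

lemma one_add_pow_le_exp {t : ℝ} (ht : 0 ≤ t) (m : ℕ) : (1 + t) ^ m ≤ Real.exp (m * t) := by
  rw [Real.exp_nat_mul]
  gcongr
  linarith [Real.add_one_le_exp t]

lemma cycleGen_nonneg (a b d : ℕ) {x : ℝ} (hx : 0 ≤ x) : 0 ≤ cycleGen a b d x := by
  unfold cycleGen; positivity

lemma cycleGen_le_exp (a b d : ℕ) {x : ℝ} (hx : 0 ≤ x) :
    cycleGen a b d x ≤ Real.exp (a * x + b * x ^ 2 + d * x ^ 3) := by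
  unfold cycleGen
  rw [Real.exp_add, Real.exp_add]
  gcongr <;> apply one_add_pow_le_exp <;> positivity

lemma cycleGen_le_exp_of_le_one {n a b d : ℕ} (h : a + 2 * b + 3 * d ≤ n) {x : ℝ} (hx : 0 ≤ x)
    (hx1 : x ≤ 1) : cycleGen a b d x ≤ Real.exp (a * x + n * x ^ 2 / 2) := by
  refine (cycleGen_le_exp a b d hx).trans (Real.exp_le_exp.2 ?_)
  have h1 : x ^ 3 ≤ x ^ 2 := pow_le_pow_of_le_one hx hx1 (by norm_num)
  have h2 : (a : ℝ) + 2 * b + 3 * d ≤ n := by exact_mod_cast h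
  have h3 : (d : ℝ) * x ^ 3 ≤ d * x ^ 2 := by gcongr
  have h4 : ((b : ℝ) + d) * x ^ 2 ≤ n / 2 * x ^ 2 := by
    gcongr
    have : (0 : ℝ) ≤ a := by positivity
    have : (0 : ℝ) ≤ d := by positivity
    linarith
  linarith

lemma exp_half_le {z : ℝ} (h0 : 0 ≤ z) (h1 : z ≤ 1) : Real.exp (z / 2) ≤ 1 + z := by
  refine (Real.exp_bound_div_one_sub_of_interval (by linarith) (by linarith)).trans ?_
  rw [div_le_iff₀ (by linarith)]
  nlinarith

lemma mul_le_choose_of_few_fixedPoints {δ A : ℝ} (hA : 0 ≤ A) (hAδ : 36 * A ≤ δ)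
    {n k a b d a' b' d' : ℕ} {P P' : ℝ} (hP' : 0 ≤ P') (hk : 1 ≤ k) (hkn : 2 * k ≤ n)
    (h : a + 2 * b + 3 * d ≤ n) (h' : a' + 2 * b' + 3 * d' ≤ n)
    (hb : (b : ℝ) + b' ≤ (1 - δ) * n)
    (ha : (a : ℝ) ≤ A * √(k * n)) (ha' : (a' : ℝ) ≤ A * √(k * n))
    (hF : ∀ x : ℝ, 0 < x → x ≤ 1 → P * x ^ k ≤ cycleGen a b d x)
    (hF' : ∀ x : ℝ, 0 < x → x ≤ 1 → P' * x ^ k ≤ cycleGen a' b' d' x) :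
    P * P' ≤ Real.exp 1 * k * Real.exp (-(δ / 12 * k)) * n.choose k := by
  have hδ : 0 ≤ δ := by linarith
  have hk0 : (0 : ℝ) < k := by exact_mod_cast hk
  have hn0 : (0 : ℝ) < n := by
    have : 0 < n := by omega
    exact_mod_cast this
  have hkn' : 2 * (k : ℝ) ≤ n := by exact_mod_cast hkn
  have hnk : ((n - k : ℕ) : ℝ) = n - k := by rw [Nat.cast_sub (by omega)]
  have hnk0 : (0 : ℝ) < (n : ℝ) - k := by linarith
  set z : ℝ := k / (n - k) with hz
  have hz0 : 0 < z := by positivity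
  have hz1 : z ≤ 1 := by rw [hz, div_le_one hnk0]; linarith
  have hzk : (k : ℝ) ≤ n * z := by
    rw [hz, ← mul_div_assoc, le_div_iff₀ hnk0]; nlinarith
  have hzk2 : n * z ≤ 2 * (k : ℝ) := by
    rw [hz, ← mul_div_assoc, div_le_iff₀ hnk0]; nlinarith
  set x : ℝ := √z with hx
  have hx0 : 0 < x := Real.sqrt_pos.2 hz0
  have hx1 : x ≤ 1 := Real.sqrt_le_iff.2 ⟨zero_le_one, by simpa using hz1⟩
  have hxx : x ^ 2 = z := Real.sq_sqrt hz0.le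
  have hx3 : x ^ 3 ≤ z := by
    rw [← hxx]; exact pow_le_pow_of_le_one hx0.le hx1 (by norm_num)
  have hxs : x * √(k * n) ≤ 3 / 2 * k := by
    rw [hx, ← Real.sqrt_mul hz0.le, Real.sqrt_le_left (by positivity)]
    nlinarith
  have key : ∀ a b d : ℕ, (a : ℝ) ≤ A * √(k * n) →
      cycleGen a b d x ≤ Real.exp (3 / 2 * A * k) * (1 + z) ^ (b + d) := by
    intro a b d ha
    unfold cycleGen
    rw [pow_add, ← mul_assoc, hxx]
    gcongr
    refine (one_add_pow_le_exp hx0.le a).trans (Real.exp_le_exp.2 ?_)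
    calc (a : ℝ) * x ≤ A * √(k * n) * x := by gcongr
      _ = A * (x * √(k * n)) := by ring
      _ ≤ A * (3 / 2 * k) := by gcongr
      _ = _ := by ring
  have h1 : P * P' * z ^ k ≤ Real.exp (3 * A * k) * (1 + z) ^ (b + d + (b' + d')) := by
    calc P * P' * z ^ k = (P * x ^ k) * (P' * x ^ k) := by rw [← hxx]; ring
      _ ≤ (Real.exp (3 / 2 * A * k) * (1 + z) ^ (b + d)) *
          (Real.exp (3 / 2 * A * k) * (1 + z) ^ (b' + d')) := by
          apply mul_le_mul_of_nonneg' ((hF x hx0 hx1).trans (key _ _ _ ha))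
            ((hF' x hx0 hx1).trans (key _ _ _ ha')) (by positivity) (by positivity)
      _ = _ := by
          rw [pow_add (1 + z) (b + d), show 3 * A * (k : ℝ) = 3 / 2 * A * k + 3 / 2 * A * k by ring,
            Real.exp_add]
          ring
  obtain ⟨e, he⟩ : ∃ e, n = b + d + (b' + d') + e := ⟨n - (b + d + (b' + d')), by omega⟩
  have hden : δ / 3 * n ≤ e := by
    have e1 : (n : ℝ) = b + d + (b' + d') + e := by exact_mod_cast he
    have e2 : (a : ℝ) + 2 * b + 3 * d ≤ n := by exact_mod_cast h
    have e3 : (a' : ℝ) + 2 * b' + 3 * d' ≤ n := by exact_mod_cast h'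
    have : (0 : ℝ) ≤ a := by positivity
    have : (0 : ℝ) ≤ a' := by positivity
    linarith
  have h2 : Real.exp (δ / 6 * k) ≤ (1 + z) ^ e := by
    calc Real.exp (δ / 6 * k) ≤ Real.exp (e * (z / 2)) := by
          apply Real.exp_le_exp.2
          have := mul_le_mul_of_nonneg_right hden (show 0 ≤ z / 2 by positivity)
          have := mul_le_mul_of_nonneg_left hzk (show 0 ≤ δ / 6 by positivity)
          linarith
      _ = Real.exp (z / 2) ^ e := by rw [Real.exp_nat_mul]
      _ ≤ _ := by gcongr; exact exp_half_le hz0.le hz1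
  have h3 : P * P' * z ^ k * Real.exp (δ / 6 * k) ≤ Real.exp (3 * A * k) * (1 + z) ^ n := by
    calc _ ≤ Real.exp (3 * A * k) * (1 + z) ^ (b + d + (b' + d')) * (1 + z) ^ e := by
          apply mul_le_mul h1 h2 (by positivity) (by positivity)
      _ = _ := by rw [mul_assoc, ← pow_add, ← he]
  have h4 : P * P' * z ^ k ≤ Real.exp (-(δ / 12 * k)) * (1 + z) ^ n := by
    have : Real.exp (3 * A * k) ≤ Real.exp (-(δ / 12 * k)) * Real.exp (δ / 6 * k) := by
      rw [← Real.exp_add]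
      apply Real.exp_le_exp.2
      nlinarith
    have h5 : P * P' * z ^ k * Real.exp (δ / 6 * k)
        ≤ Real.exp (-(δ / 12 * k)) * Real.exp (δ / 6 * k) * (1 + z) ^ n :=
      h3.trans (by gcongr)
    refine le_of_mul_le_mul_right (a := Real.exp (δ / 6 * k)) ?_ (Real.exp_pos _)
    linarith
  have hz' : z ^ k * (n - k) ^ n = (k : ℝ) ^ k * (n - k) ^ (n - k) := by
    have hsplit : ((n : ℝ) - k) ^ n = (n - k) ^ k * (n - k) ^ (n - k) := by
      rw [← pow_add]; congr 1; omega
    rw [hsplit, ← mul_assoc, ← mul_pow, hz, div_mul_cancel₀ _ hnk0.ne']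
  have hz'' : (1 + z) ^ n * (n - k) ^ n = (n : ℝ) ^ n := by
    rw [← mul_pow, hz]; congr 1; field_simp; ring
  have hent := pow_self_le_choose hk (show k ≤ n by omega)
  rw [hnk] at hent
  have hpos : (0 : ℝ) < (k : ℝ) ^ k * (n - k) ^ (n - k) := by positivity
  refine le_of_mul_le_mul_right ?_ hpos
  calc P * P' * ((k : ℝ) ^ k * (n - k) ^ (n - k))
      = P * P' * z ^ k * (n - k) ^ n := by rw [← hz']; ring
    _ ≤ Real.exp (-(δ / 12 * k)) * (1 + z) ^ n * (n - k) ^ n := by gcongr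
    _ = Real.exp (-(δ / 12 * k)) * (n : ℝ) ^ n := by rw [mul_assoc, hz'']
    _ ≤ Real.exp (-(δ / 12 * k)) *
        (Real.exp 1 * k * (k : ℝ) ^ k * (n - k) ^ (n - k) * n.choose k) := by gcongr
    _ = _ := by ring

/-- A bound on `cycleGen` at a multiple of `a / n`, where `a` is the number of fixed points of
the other permutation. -/
lemma cycleGen_le_exp_of_mul_le {M B : ℝ} (hB : 0 ≤ B)
    {n a a' b' d' : ℕ} (hn : 1 ≤ n) (h' : a' + 2 * b' + 3 * d' ≤ n)
    (haa : (a : ℝ) * a' ≤ M * n) (hab : (a : ℝ) * √b' ≤ M * n)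
    (ha3 : B ^ 3 * (a : ℝ) ^ 3 ≤ (n : ℝ) ^ 2) :
    cycleGen a' b' d' (B * a / n) ≤ Real.exp (B * M + B ^ 2 * M ^ 2 + 1) := by
  have hn0 : (0 : ℝ) < n := by exact_mod_cast hn
  refine (cycleGen_le_exp _ _ _ (by positivity)).trans (Real.exp_le_exp.2 ?_)
  have e1 : (a' : ℝ) * (B * a / n) ≤ B * M := by
    rw [show (a' : ℝ) * (B * a / n) = B * (a * a') / n by ring, div_le_iff₀ hn0]
    nlinarith
  have e2 : (b' : ℝ) * (B * a / n) ^ 2 ≤ B ^ 2 * M ^ 2 := by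
    have : (b' : ℝ) * (B * a / n) ^ 2 = B ^ 2 * (a * √b') ^ 2 / n ^ 2 := by
      rw [mul_pow (a : ℝ), Real.sq_sqrt (by positivity)]; ring
    rw [this, div_le_iff₀ (by positivity)]
    have : ((a : ℝ) * √b') ^ 2 ≤ (M * n) ^ 2 := by gcongr
    nlinarith [sq_nonneg B]
  have e3 : (d' : ℝ) * (B * a / n) ^ 3 ≤ 1 := by
    have hd : (d' : ℝ) ≤ n := by
      have : d' ≤ n := by omega
      exact_mod_cast this
    rw [show (d' : ℝ) * (B * a / n) ^ 3 = d' * (B ^ 3 * a ^ 3) / n ^ 3 by ring,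
      div_le_one (by positivity)]
    calc (d' : ℝ) * (B ^ 3 * a ^ 3) ≤ (n : ℝ) * (n : ℝ) ^ 2 := by gcongr
      _ = (n : ℝ) ^ 3 := by ring
  linarith

lemma mul_le_choose_of_many_fixedPoints {M A B : ℝ} (hA : 0 < A)
    (hB : B = Real.exp (2 + 1 / (2 * A ^ 2)))
    {n k a b d a' b' d' : ℕ} {P P' : ℝ} (hP' : 0 ≤ P') (hk : 1 ≤ k) (hkn : 2 * k ≤ n)
    (h : a + 2 * b + 3 * d ≤ n) (h' : a' + 2 * b' + 3 * d' ≤ n)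
    (haa : (a : ℝ) * a' ≤ M * n) (hab : (a : ℝ) * √b' ≤ M * n)
    (ha3 : (a : ℝ) ^ 3 ≤ A ^ 6 * (n : ℝ) ^ 2) (ha3' : B ^ 3 * (a : ℝ) ^ 3 ≤ (n : ℝ) ^ 2)
    (ha : A * √(k * n) < a)
    (hF : ∀ x : ℝ, 0 < x → x ≤ 1 → P * x ^ k ≤ cycleGen a b d x)
    (hF' : ∀ x : ℝ, 0 < x → x ≤ 1 → P' * x ^ k ≤ cycleGen a' b' d' x) :
    P * P' ≤ Real.exp (B * M + B ^ 2 * M ^ 2 + 2) * k * Real.exp (-k) * n.choose k := by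
  have hk0 : (0 : ℝ) < k := by exact_mod_cast hk
  have hn1 : (1 : ℝ) ≤ n := by
    have : 1 ≤ n := by omega
    exact_mod_cast this
  have hn0 : (0 : ℝ) < n := by linarith
  have ha0 : (0 : ℝ) < a := lt_of_le_of_lt (by positivity) ha
  have hB0 : 0 < B := hB ▸ Real.exp_pos _
  have hsq : A ^ 2 * (k * n) ≤ (a : ℝ) ^ 2 := by
    calc A ^ 2 * (k * n) = (A * √(k * n)) ^ 2 := by
          rw [mul_pow, Real.sq_sqrt (by positivity)]
      _ ≤ _ := by gcongr
  have haA : (a : ℝ) ≤ A ^ 2 * n := by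
    have : (a : ℝ) ^ 3 ≤ (A ^ 2 * n) ^ 3 := by
      calc (a : ℝ) ^ 3 ≤ A ^ 6 * (n : ℝ) ^ 2 := ha3
        _ ≤ A ^ 6 * (n : ℝ) ^ 3 := by
            gcongr
            norm_num
        _ = _ := by ring
    exact le_of_pow_le_pow_left₀ (by norm_num) (by positivity) this
  have hka : (k : ℝ) ≤ a := by
    have h1 : A ^ 2 * n * k ≤ A ^ 2 * n * a := by nlinarith
    exact le_of_mul_le_mul_left h1 (by positivity)
  set x : ℝ := k / a with hx
  have hx0 : 0 < x := by positivity
  have hx1 : x ≤ 1 := by rw [hx, div_le_one ha0]; exact hka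
  set y : ℝ := B * a / n with hy
  have hy0 : 0 < y := by positivity
  have hy1 : y ≤ 1 := by
    have : y ^ 3 ≤ 1 := by
      rw [hy, div_pow, mul_pow, div_le_one (by positivity)]
      exact ha3'.trans (pow_le_pow_right₀ hn1 (by norm_num))
    by_contra! hcon
    linarith [one_lt_pow₀ hcon (show 3 ≠ 0 by norm_num)]
  have h1 : P * x ^ k ≤ Real.exp (k + 1 / (2 * A ^ 2) * k) := by
    refine ((hF x hx0 hx1).trans (cycleGen_le_exp_of_le_one h hx0.le hx1)).trans
      (Real.exp_le_exp.2 ?_)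
    have e1 : (a : ℝ) * x = k := by rw [hx]; field_simp
    have e2 : n * x ^ 2 / 2 ≤ 1 / (2 * A ^ 2) * k := by
      rw [hx, div_pow, ← mul_div_assoc, div_div, div_le_iff₀ (by positivity)]
      calc (n : ℝ) * k ^ 2 = 1 / (2 * A ^ 2) * k * (A ^ 2 * (k * n) * 2) := by field_simp
        _ ≤ _ := by gcongr
    linarith
  have h2 : P' * y ^ k ≤ Real.exp (B * M + B ^ 2 * M ^ 2 + 1) :=
    (hF' y hy0 hy1).trans (cycleGen_le_exp_of_mul_le hB0.le (by omega) h' haa hab ha3')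
  have h3 : P * P' * (x * y) ^ k ≤
      Real.exp (k + 1 / (2 * A ^ 2) * k) * Real.exp (B * M + B ^ 2 * M ^ 2 + 1) := by
    calc P * P' * (x * y) ^ k = (P * x ^ k) * (P' * y ^ k) := by ring
      _ ≤ _ := mul_le_mul_of_nonneg' h1 h2 (by positivity) (by positivity)
  have hxy : (x * y) ^ k * n ^ k = (k : ℝ) ^ k * B ^ k := by
    rw [← mul_pow, ← mul_pow, hx, hy]; congr 1; field_simp
  have hBk : B ^ k = Real.exp (k + 1 / (2 * A ^ 2) * k) * Real.exp k := by
    rw [hB, ← Real.exp_nat_mul, ← Real.exp_add]; congr 1; ring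
  have hch := pow_le_choose hk (show k ≤ n by omega)
  have hpos : (0 : ℝ) < (k : ℝ) ^ k * B ^ k := by positivity
  refine le_of_mul_le_mul_right ?_ hpos
  calc P * P' * ((k : ℝ) ^ k * B ^ k) = P * P' * (x * y) ^ k * n ^ k := by rw [← hxy]; ring
    _ ≤ Real.exp (k + 1 / (2 * A ^ 2) * k) * Real.exp (B * M + B ^ 2 * M ^ 2 + 1) *
        (Real.exp 1 * k * (k : ℝ) ^ k * n.choose k) := by gcongr
    _ = Real.exp (B * M + B ^ 2 * M ^ 2 + 2) * k * Real.exp (-k) * n.choose k *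
        ((k : ℝ) ^ k * B ^ k) := by
        have hE : Real.exp (B * M + B ^ 2 * M ^ 2 + 2) =
            Real.exp (B * M + B ^ 2 * M ^ 2 + 1) * Real.exp 1 := by
          rw [← Real.exp_add]; congr 1; ring
        have hk1 : Real.exp (-(k : ℝ)) * Real.exp k = 1 := by rw [← Real.exp_add]; simp
        rw [hBk, hE]
        linear_combination (-(Real.exp (k + 1 / (2 * A ^ 2) * k) *
          Real.exp (B * M + B ^ 2 * M ^ 2 + 1) *
          (Real.exp 1 * k * (k : ℝ) ^ k * n.choose k))) * hk1

/-- Exponential decay of the expected number of common invariant sets of size `k ≤ n / 2`. -/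
lemma exists_mul_le_choose {δ M : ℝ} (hδ : 0 < δ) (hM : 0 ≤ M) :
    ∃ C c ε : ℝ, 0 < C ∧ 0 < c ∧ 0 < ε ∧ ∀ (n k a b d a' b' d' : ℕ) (P P' : ℝ),
      0 ≤ P → 0 ≤ P' → 1 ≤ k → 2 * k ≤ n →
      a + 2 * b + 3 * d ≤ n → a' + 2 * b' + 3 * d' ≤ n →
      ((a : ℝ) + √b) * (a' + √b') ≤ M * n →
      (a : ℝ) ^ 3 ≤ ε * (n : ℝ) ^ 2 → (a' : ℝ) ^ 3 ≤ ε * (n : ℝ) ^ 2 →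
      (b : ℝ) + b' ≤ (1 - δ) * n →
      (∀ x : ℝ, 0 < x → x ≤ 1 → P * x ^ k ≤ cycleGen a b d x) →
      (∀ x : ℝ, 0 < x → x ≤ 1 → P' * x ^ k ≤ cycleGen a' b' d' x) →
      P * P' ≤ C * (k * Real.exp (-(c * k))) * n.choose k := by
  set A : ℝ := δ / 36 with hA
  have hA0 : 0 < A := by positivity
  set B : ℝ := Real.exp (2 + 1 / (2 * A ^ 2)) with hB
  have hB0 : 0 < B := Real.exp_pos _
  refine ⟨Real.exp (B * M + B ^ 2 * M ^ 2 + 2), min (δ / 12) 1, min (A ^ 6) (1 / B ^ 3),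
    Real.exp_pos _, by positivity, by positivity, ?_⟩
  intro n k a b d a' b' d' P P' hP hP' hk hkn h h' hprod ha3 ha3' hb hF hF'
  have s := Real.sqrt_nonneg (b : ℝ)
  have s' := Real.sqrt_nonneg (b' : ℝ)
  have t : (0 : ℝ) ≤ a := by positivity
  have t' : (0 : ℝ) ≤ a' := by positivity
  have hE1 : Real.exp (-k) ≤ Real.exp (-(min (δ / 12) 1 * k)) := by
    apply Real.exp_le_exp.2
    have := mul_le_mul_of_nonneg_right (min_le_right (δ / 12) 1) (Nat.cast_nonneg (α := ℝ) k)
    linarith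
  have hcube : ∀ u : ℝ, u ^ 3 ≤ min (A ^ 6) (1 / B ^ 3) * (n : ℝ) ^ 2 →
      u ^ 3 ≤ A ^ 6 * (n : ℝ) ^ 2 ∧ B ^ 3 * u ^ 3 ≤ (n : ℝ) ^ 2 := by
    intro u hu
    refine ⟨hu.trans (by gcongr; exact min_le_left _ _), ?_⟩
    have : u ^ 3 ≤ 1 / B ^ 3 * (n : ℝ) ^ 2 := hu.trans (by gcongr; exact min_le_right _ _)
    calc B ^ 3 * u ^ 3 ≤ B ^ 3 * (1 / B ^ 3 * (n : ℝ) ^ 2) := by gcongr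
      _ = _ := by field_simp
  by_cases c1 : A * √(k * n) < a
  · refine (mul_le_choose_of_many_fixedPoints (M := M) hA0 hB hP' hk hkn h h' (by nlinarith)
      (by nlinarith) (hcube _ ha3).1 (hcube _ ha3).2 c1 hF hF').trans ?_
    rw [← mul_assoc]
    gcongr
  by_cases c2 : A * √(k * n) < a'
  · rw [mul_comm P]
    refine (mul_le_choose_of_many_fixedPoints (M := M) hA0 hB hP hk hkn h' h (by nlinarith)
      (by nlinarith) (hcube _ ha3').1 (hcube _ ha3').2 c2 hF' hF).trans ?_
    rw [← mul_assoc]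
    gcongr
  · refine (mul_le_choose_of_few_fixedPoints hA0.le (by rw [hA]; linarith) hP' hk hkn h h' hb
      (not_lt.1 c1) (not_lt.1 c2) hF hF').trans ?_
    rw [← mul_assoc]
    gcongr
    · have : 0 ≤ B * M + B ^ 2 * M ^ 2 := by positivity
      linarith
    · exact min_le_left _ _

/-- A choice of parameters at which both generating functions are bounded. -/
lemma exists_cycleGen_le {M : ℝ} (hM : 0 ≤ M) {n a b d a' b' d' : ℕ} {ε : ℝ} (hε1 : ε ≤ 1)
    (hn : 1 ≤ n) (hnε : 1 ≤ ε * √n)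
    (h : a + 2 * b + 3 * d ≤ n) (h' : a' + 2 * b' + 3 * d' ≤ n)
    (hprod : ((a : ℝ) + √b) * (a' + √b') ≤ M * n)
    (ha : (a : ℝ) ≤ ε * n) (ha' : (a' : ℝ) ≤ ε * n)
    (ha3 : (a : ℝ) ^ 3 ≤ (n : ℝ) ^ 2) (ha3' : (a' : ℝ) ^ 3 ≤ (n : ℝ) ^ 2) :
    ∃ x y : ℝ, 0 < x ∧ 0 < y ∧ x ≤ ε ∧ y ≤ ε ∧ x * y * n = 1 ∧
      cycleGen a b d x ≤ Real.exp (M + M ^ 2 + 2) ∧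
      cycleGen a' b' d' y ≤ Real.exp (M + M ^ 2 + 2) := by
  have hn0 : (0 : ℝ) < n := by exact_mod_cast hn
  have s := Real.sqrt_nonneg (b : ℝ)
  have s' := Real.sqrt_nonneg (b' : ℝ)
  have t : (0 : ℝ) ≤ a := by positivity
  have t' : (0 : ℝ) ≤ a' := by positivity
  have hs0 : 0 < √(n : ℝ) := Real.sqrt_pos.2 hn0
  have hsn : √(n : ℝ) * √n = n := Real.mul_self_sqrt hn0.le
  have hM2 : 0 ≤ M + M ^ 2 := by positivity
  have hinv : 1 / √(n : ℝ) ≤ ε := by rw [div_le_iff₀ hs0]; exact hnε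
  have small : ∀ (a b d : ℕ) (u : ℝ), a + 2 * b + 3 * d ≤ n → 0 < u → √n ≤ u →
      (a : ℝ) ≤ u → cycleGen a b d (1 / u) ≤ Real.exp (M + M ^ 2 + 2) := by
    intro a b d u h hu hnu hau
    have hu1 : 1 / u ≤ 1 := by
      refine le_trans ?_ (hinv.trans hε1)
      gcongr
    refine (cycleGen_le_exp_of_le_one h (by positivity) hu1).trans (Real.exp_le_exp.2 ?_)
    have e1 : (a : ℝ) * (1 / u) ≤ 1 := by rw [mul_one_div, div_le_one hu]; exact hau
    have e2 : (n : ℝ) * (1 / u) ^ 2 ≤ 1 := by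
      rw [div_pow, one_pow, mul_one_div, div_le_one (by positivity)]
      nlinarith
    linarith
  have large : ∀ (a a' b' d' : ℕ), a' + 2 * b' + 3 * d' ≤ n → (a : ℝ) * a' ≤ M * n →
      (a : ℝ) * √b' ≤ M * n → (a : ℝ) ^ 3 ≤ (n : ℝ) ^ 2 →
      cycleGen a' b' d' (a / n) ≤ Real.exp (M + M ^ 2 + 2) := by
    intro a a' b' d' h' h1 h2 h3
    have := cycleGen_le_exp_of_mul_le (B := 1) zero_le_one hn h' h1 h2 (by simpa using h3)
    simp only [one_mul, one_pow] at this
    refine this.trans (Real.exp_le_exp.2 (by linarith))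
  by_cases c1 : √(n : ℝ) < a
  · have ha0 : (0 : ℝ) < a := hs0.trans c1
    refine ⟨1 / a, a / n, by positivity, by positivity, le_trans (by gcongr) hinv,
      by rw [div_le_iff₀ hn0]; exact ha, by field_simp, small _ _ _ _ h ha0 c1.le le_rfl,
      large _ _ _ _ h' (by nlinarith) (by nlinarith) ha3⟩
  by_cases c2 : √(n : ℝ) < a'
  · have ha0 : (0 : ℝ) < a' := hs0.trans c2
    refine ⟨a' / n, 1 / a', by positivity, by positivity, by rw [div_le_iff₀ hn0]; exact ha',
      le_trans (by gcongr) hinv, by field_simp,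
      large _ _ _ _ h (by nlinarith) (by nlinarith) ha3', small _ _ _ _ h' ha0 c2.le le_rfl⟩
  · refine ⟨1 / √n, 1 / √n, by positivity, by positivity, hinv, hinv, ?_,
      small _ _ _ _ h hs0 le_rfl (not_lt.1 c1), small _ _ _ _ h' hs0 le_rfl (not_lt.1 c2)⟩
    field_simp
    exact (Real.sq_sqrt hn0.le).symm

section InvariantSets

variable {α : Type*} [Fintype α] [DecidableEq α]

/-- The sets invariant under the permutation `π`. -/
def invSets (π : Equiv.Perm α) : Finset (Finset α) :=
  Finset.univ.filter fun A => ∀ x ∈ A, π x ∈ A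

lemma mem_invSets {π : Equiv.Perm α} {A : Finset α} : A ∈ invSets π ↔ ∀ x ∈ A, π x ∈ A := by
  simp [invSets]

lemma mem_of_sameCycle_of_mem_invSets {π : Equiv.Perm α} {A : Finset α} (hA : A ∈ invSets π)
    {x y : α} (h : π.SameCycle x y) (hx : x ∈ A) : y ∈ A := by
  obtain ⟨i, -, rfl⟩ := h.exists_pow_eq'
  clear h
  induction i with
  | zero => simpa
  | succ i ih => rw [pow_succ']; exact mem_invSets.1 hA _ ih

/-- The set of fixed points. -/
def fixedFinset (π : Equiv.Perm α) : Finset α := Finset.univ.filter fun x => π x = x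

/-- The cycles of length two. -/
def twoCycles (π : Equiv.Perm α) : Finset (Equiv.Perm α) :=
  π.cycleFactorsFinset.filter fun c => c.support.card = 2

/-- The cycles of length at least three. -/
def longCycles (π : Equiv.Perm α) : Finset (Equiv.Perm α) :=
  π.cycleFactorsFinset.filter fun c => ¬ c.support.card = 2

lemma three_le_card_support_of_mem_longCycles {π c : Equiv.Perm α} (hc : c ∈ longCycles π) :
    3 ≤ c.support.card := by
  rw [longCycles, Finset.mem_filter] at hc
  have := (Equiv.Perm.mem_cycleFactorsFinset_iff.1 hc.1).1.two_le_card_support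
  omega

lemma card_fixedFinset_add_le (π : Equiv.Perm α) :
    (fixedFinset π).card + 2 * (twoCycles π).card + 3 * (longCycles π).card ≤ Fintype.card α := by
  have h1 : ∑ c ∈ π.cycleFactorsFinset, c.support.card = π.support.card := by
    rw [← Equiv.Perm.sum_cycleType, Equiv.Perm.cycleType_def]; rfl
  have h2 : ∑ c ∈ twoCycles π, c.support.card + ∑ c ∈ longCycles π, c.support.card
      = π.support.card := by
    rw [← h1]; exact Finset.sum_filter_add_sum_filter_not _ _ _
  have h3 : ∑ c ∈ twoCycles π, c.support.card = 2 * (twoCycles π).card := by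
    rw [mul_comm]
    exact Finset.sum_const_nat fun c hc => (Finset.mem_filter.1 hc).2
  have h4 : 3 * (longCycles π).card ≤ ∑ c ∈ longCycles π, c.support.card := by
    rw [mul_comm, ← smul_eq_mul]
    exact Finset.card_nsmul_le_sum _ _ _ fun c hc => three_le_card_support_of_mem_longCycles hc
  have h5 : (fixedFinset π).card + π.support.card = Fintype.card α := by
    exact Finset.card_filter_add_card_filter_not (s := Finset.univ) (fun x => π x = x)
  omega

lemma eq_union_of_mem_invSets {π : Equiv.Perm α} {A : Finset α} (hA : A ∈ invSets π) :
    A = (A ∩ fixedFinset π) ∪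
      (π.cycleFactorsFinset.filter fun c => c.support ⊆ A).biUnion Equiv.Perm.support := by
  ext y
  simp only [Finset.mem_union, Finset.mem_inter, Finset.mem_biUnion, Finset.mem_filter]
  constructor
  · intro hy
    by_cases hf : π y = y
    · exact Or.inl ⟨hy, by simp [fixedFinset, hf]⟩
    · have hs : y ∈ π.support := Equiv.Perm.mem_support.2 hf
      refine Or.inr ⟨π.cycleOf y, ⟨Equiv.Perm.cycleOf_mem_cycleFactorsFinset_iff.2 hs, ?_⟩, ?_⟩
      · intro z hz
        exact mem_of_sameCycle_of_mem_invSets hA (Equiv.Perm.mem_support_cycleOf_iff.1 hz).1 hy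
      · exact Equiv.Perm.mem_support_cycleOf_iff.2 ⟨Equiv.Perm.SameCycle.refl _ _, hs⟩
  · rintro (h | ⟨c, ⟨-, hc⟩, hy⟩)
    · exact h.1
    · exact hc hy

lemma card_of_mem_invSets {π : Equiv.Perm α} {A : Finset α} (hA : A ∈ invSets π) :
    A.card = (A ∩ fixedFinset π).card +
      ∑ c ∈ π.cycleFactorsFinset.filter (fun c => c.support ⊆ A), c.support.card := by
  conv_lhs => rw [eq_union_of_mem_invSets hA]
  rw [Finset.card_union_of_disjoint, Finset.card_biUnion]
  · intro c hc c' hc' hne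
    exact (Equiv.Perm.cycleFactorsFinset_pairwise_disjoint π (Finset.mem_filter.1 hc).1
      (Finset.mem_filter.1 hc').1 hne).disjoint_support
  · rw [Finset.disjoint_biUnion_right]
    intro c hc
    rw [Finset.disjoint_left]
    intro y hy hyc
    have h1 := (Finset.mem_filter.1 (Finset.mem_inter.1 hy).2).2
    have h2 := Equiv.Perm.mem_cycleFactorsFinset_support_le (Finset.mem_filter.1 hc).1 hyc
    exact Equiv.Perm.mem_support.1 h2 h1

lemma sum_invSets_pow_le (π : Equiv.Perm α) {x : ℝ} (hx : 0 ≤ x) (hx1 : x ≤ 1) :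
    ∑ A ∈ invSets π, x ^ A.card ≤
      cycleGen (fixedFinset π).card (twoCycles π).card (longCycles π).card x := by
  have h1 : ∑ A ∈ invSets π, x ^ A.card ≤
      ∑ p ∈ (fixedFinset π).powerset ×ˢ π.cycleFactorsFinset.powerset,
        x ^ p.1.card * ∏ c ∈ p.2, x ^ c.support.card := by
    have hinj : Set.InjOn (fun A : Finset α => (A ∩ fixedFinset π,
        π.cycleFactorsFinset.filter fun c => c.support ⊆ A)) (invSets π) := by
      intro A hA A' hA' h
      simp only [Prod.mk.injEq] at h
      rw [eq_union_of_mem_invSets hA, eq_union_of_mem_invSets hA', h.1, h.2]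
    rw [Finset.sum_congr rfl (g := fun A : Finset α =>
      (fun p : Finset α × Finset (Equiv.Perm α) =>
        x ^ p.1.card * ∏ c ∈ p.2, x ^ c.support.card) (A ∩ fixedFinset π,
        π.cycleFactorsFinset.filter fun c => c.support ⊆ A))
      (fun A hA => by
        simp only
        rw [card_of_mem_invSets hA, pow_add, Finset.prod_pow_eq_pow_sum]),
      ← Finset.sum_image (s := invSets π) (g := fun A : Finset α => (A ∩ fixedFinset π,
        π.cycleFactorsFinset.filter fun c => c.support ⊆ A)) (f :=
        fun p : Finset α × Finset (Equiv.Perm α) =>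
        x ^ p.1.card * ∏ c ∈ p.2, x ^ c.support.card) hinj]
    refine Finset.sum_le_sum_of_subset_of_nonneg ?_ fun p _ _ => by positivity
    intro p hp
    obtain ⟨A, -, rfl⟩ := Finset.mem_image.1 hp
    simp [Finset.mem_product]
  refine h1.trans ?_
  rw [Finset.sum_product]
  simp_rw [← Finset.mul_sum, ← Finset.sum_mul, ← Finset.prod_one_add]
  have h2 : ∑ S ∈ (fixedFinset π).powerset, x ^ S.card = (1 + x) ^ (fixedFinset π).card := by
    have := Finset.prod_one_add (f := fun _ : α => x) (fixedFinset π)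
    simp only [Finset.prod_const] at this
    exact this.symm
  have h3 : ∏ c ∈ π.cycleFactorsFinset, (1 + x ^ c.support.card) =
      (∏ c ∈ twoCycles π, (1 + x ^ c.support.card)) *
        ∏ c ∈ longCycles π, (1 + x ^ c.support.card) :=
    (Finset.prod_filter_mul_prod_filter_not _ _ _).symm
  rw [h2, h3, cycleGen, mul_assoc]
  gcongr
  · rw [Finset.prod_congr rfl fun c hc => by rw [(Finset.mem_filter.1 hc).2]]
    simp
  · rw [← Finset.prod_const]
    refine Finset.prod_le_prod (fun _ _ => by positivity) fun c hc => ?_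
    linarith [pow_le_pow_of_le_one hx hx1 (three_le_card_support_of_mem_longCycles hc)]

lemma sum_invSets_mem_pow_le (π : Equiv.Perm α) (v : α) {x : ℝ} (hx : 0 ≤ x) (hx1 : x ≤ 1) :
    ∑ A ∈ (invSets π).filter (v ∈ ·), x ^ A.card ≤ x * ∑ A ∈ invSets π, x ^ A.card := by
  classical
  set O : Finset α := Finset.univ.filter fun y => π.SameCycle v y with hO
  have hsub : ∀ A ∈ (invSets π).filter (v ∈ ·), O ⊆ A := by
    intro A hA y hy
    rw [Finset.mem_filter] at hA hy
    exact mem_of_sameCycle_of_mem_invSets hA.1 hy.2 hA.2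
  have hO1 : 1 ≤ O.card := Finset.card_pos.2 ⟨v, by simp [hO, Equiv.Perm.SameCycle.refl]⟩
  have hinj : Set.InjOn (fun A : Finset α => A \ O) ((invSets π).filter (v ∈ ·)) := by
    intro A hA A' hA' h
    have h' : A \ O = A' \ O := h
    rw [← Finset.sdiff_union_of_subset (hsub A hA), ← Finset.sdiff_union_of_subset (hsub A' hA'),
      h']
  calc ∑ A ∈ (invSets π).filter (v ∈ ·), x ^ A.card
      ≤ ∑ A ∈ (invSets π).filter (v ∈ ·), x * x ^ (A \ O).card := by
        gcongr with A hA
        rw [← pow_succ']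
        apply pow_le_pow_of_le_one hx hx1
        have := Finset.card_sdiff_add_card_eq_card (hsub A hA)
        omega
    _ = x * ∑ A ∈ ((invSets π).filter (v ∈ ·)).image (fun A => A \ O), x ^ A.card := by
        rw [Finset.sum_image hinj, Finset.mul_sum]
    _ ≤ _ := by
        gcongr
        intro B hB
        obtain ⟨A, hA, rfl⟩ := Finset.mem_image.1 hB
        rw [mem_invSets]
        intro y hy
        rw [Finset.mem_sdiff, hO, Finset.mem_filter] at hy ⊢
        refine ⟨mem_invSets.1 (Finset.mem_filter.1 hA).1 _ hy.1, ?_⟩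
        simpa using hy.2

/-- The number of invariant sets of size `k`. -/
def invCount (π : Equiv.Perm α) (k : ℕ) : ℕ := ((invSets π).filter fun A => A.card = k).card

/-- The number of invariant sets of size `k` containing `v`. -/
def invCountAt (π : Equiv.Perm α) (v : α) (k : ℕ) : ℕ :=
  ((invSets π).filter fun A => v ∈ A ∧ A.card = k).card

lemma invCount_mul_pow_le (π : Equiv.Perm α) (k : ℕ) {x : ℝ} (hx : 0 ≤ x) (hx1 : x ≤ 1) :
    invCount π k * x ^ k ≤
      cycleGen (fixedFinset π).card (twoCycles π).card (longCycles π).card x := by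
  refine le_trans ?_ (sum_invSets_pow_le π hx hx1)
  rw [invCount, ← nsmul_eq_mul, ← Finset.sum_const,
    Finset.sum_congr rfl fun A hA => by rw [← (Finset.mem_filter.1 hA).2]]
  exact Finset.sum_le_sum_of_subset_of_nonneg (Finset.filter_subset _ _) fun p _ _ => by positivity

lemma invCountAt_mul_pow_le (π : Equiv.Perm α) (v : α) (k : ℕ) {x : ℝ} (hx : 0 ≤ x)
    (hx1 : x ≤ 1) : invCountAt π v k * x ^ k ≤
      x * cycleGen (fixedFinset π).card (twoCycles π).card (longCycles π).card x := by
  refine le_trans ?_ ((sum_invSets_mem_pow_le π v hx hx1).trans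
    (mul_le_mul_of_nonneg_left (sum_invSets_pow_le π hx hx1) hx))
  rw [invCountAt, ← nsmul_eq_mul, ← Finset.sum_const,
    Finset.sum_congr rfl fun A hA => by rw [← (Finset.mem_filter.1 hA).2.2]]
  rw [← Finset.filter_filter]
  exact Finset.sum_le_sum_of_subset_of_nonneg (Finset.filter_subset _ _) fun p _ _ => by positivity

end InvariantSets

section PartialPermutations

open Finset

variable {α : Type*} [Fintype α] [DecidableEq α]

lemma sum_union_le_add {β : Type*} [DecidableEq β] (s t : Finset β) {f : β → ℝ}
    (hf : ∀ x, 0 ≤ f x) : ∑ x ∈ s ∪ t, f x ≤ ∑ x ∈ s, f x + ∑ x ∈ t, f x := by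
  rw [← sum_union_inter]
  linarith [sum_nonneg fun x (_ : x ∈ s ∩ t) => hf x]

lemma sum_biUnion_le_sum_sum {γ β : Type*} [DecidableEq β] (S : Finset γ) (g : γ → Finset β)
    {f : β → ℝ} (hf : ∀ x, 0 ≤ f x) : ∑ x ∈ S.biUnion g, f x ≤ ∑ v ∈ S, ∑ x ∈ g v, f x := by
  classical
  induction S using Finset.induction_on with
  | empty => simp
  | insert v S hv ih =>
    rw [biUnion_insert, sum_insert hv]
    exact (sum_union_le_add _ _ hf).trans (by gcongr)

/-- The permutations whose graph contains `M`. -/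
def extSet (M : Finset (α × α)) : Finset (Equiv.Perm α) :=
  univ.filter fun σ => ∀ p ∈ M, σ p.1 = p.2

lemma mem_extSet {M : Finset (α × α)} {σ : Equiv.Perm α} :
    σ ∈ extSet M ↔ ∀ p ∈ M, σ p.1 = p.2 := by
  simp [extSet]

lemma mem_extSet_union {M M' : Finset (α × α)} {σ : Equiv.Perm α} :
    σ ∈ extSet (M ∪ M') ↔ σ ∈ extSet M ∧ σ ∈ extSet M' := by
  simp only [mem_extSet, mem_union]
  exact ⟨fun h => ⟨fun p hp => h p (Or.inl hp), fun p hp => h p (Or.inr hp)⟩,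
    fun h p hp => hp.elim (h.1 p) (h.2 p)⟩

lemma card_image_fst_of_mem_extSet {M : Finset (α × α)} {σ : Equiv.Perm α} (h : σ ∈ extSet M) :
    (M.image Prod.fst).card = M.card := by
  refine card_image_of_injOn fun p hp q hq hpq => Prod.ext hpq ?_
  rw [← mem_extSet.1 h p hp, ← mem_extSet.1 h q hq, hpq]

lemma card_extSet {M : Finset (α × α)} {σ : Equiv.Perm α} (h : σ ∈ extSet M) :
    (extSet M).card = (Fintype.card α - M.card).factorial := by
  set D := M.image Prod.fst with hD
  have hchar : ∀ τ, τ ∈ extSet M ↔ ∀ x ∈ D, τ x = σ x := by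
    intro τ
    rw [mem_extSet, hD]
    constructor
    · intro hτ x hx
      obtain ⟨p, hp, rfl⟩ := mem_image.1 hx
      rw [hτ p hp, mem_extSet.1 h p hp]
    · intro hτ p hp
      rw [hτ p.1 (mem_image_of_mem _ hp), mem_extSet.1 h p hp]
  have e1 := Fintype.card_congr (Equiv.Perm.subtypeEquivSubtypePerm fun x : α => x ∉ D)
  rw [Fintype.card_perm, Fintype.card_subtype_compl, Fintype.card_coe,
    hD, card_image_fst_of_mem_extSet h, ← hD, Fintype.card_subtype] at e1
  rw [e1]
  refine card_bij' (fun τ _ => σ⁻¹ * τ) (fun τ _ => σ * τ) ?_ ?_ ?_ ?_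
  · intro τ hτ
    simp only [mem_filter, mem_univ, true_and, not_not, Equiv.Perm.mul_apply]
    intro x hx
    rw [(hchar τ).1 hτ x hx]; simp
  · intro τ hτ
    simp only [mem_filter, mem_univ, true_and, not_not] at hτ
    rw [hchar]
    intro x hx
    rw [Equiv.Perm.mul_apply, hτ x hx]
  · intro τ _; simp
  · intro τ _; simp

lemma exists_mem_extSet_union {M θ : Finset (α × α)} {σ τ : Equiv.Perm α} (hσ : σ ∈ extSet M)
    (hτ : τ ∈ extSet θ) (h1 : Disjoint (M.image Prod.fst) (θ.image Prod.fst))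
    (h2 : Disjoint (M.image Prod.snd) (θ.image Prod.snd)) : ∃ ρ, ρ ∈ extSet (M ∪ θ) := by
  set f : α → α := fun x => if x ∈ M.image Prod.fst then σ x else τ x with hf
  have hfM : ∀ p ∈ M, f p.1 = p.2 := by
    intro p hp
    rw [hf]
    simp only [if_pos (mem_image_of_mem Prod.fst hp)]
    exact mem_extSet.1 hσ p hp
  have hfθ : ∀ p ∈ θ, f p.1 = p.2 := by
    intro p hp
    rw [hf]
    simp only [if_neg (disjoint_right.1 h1 (mem_image_of_mem Prod.fst hp))]
    exact mem_extSet.1 hτ p hp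
  have hinj : Set.InjOn f ((M ∪ θ).image Prod.fst) := by
    intro x hx y hy hxy
    obtain ⟨p, hp, rfl⟩ := mem_image.1 hx
    obtain ⟨q, hq, rfl⟩ := mem_image.1 hy
    rcases mem_union.1 hp with hp | hp <;> rcases mem_union.1 hq with hq | hq
    · rw [hfM p hp, hfM q hq, ← mem_extSet.1 hσ p hp, ← mem_extSet.1 hσ q hq] at hxy
      exact σ.injective hxy
    · rw [hfM p hp, hfθ q hq] at hxy
      exact absurd (hxy ▸ mem_image_of_mem Prod.snd hp)
        (disjoint_right.1 h2 (mem_image_of_mem Prod.snd hq))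
    · rw [hfθ p hp, hfM q hq] at hxy
      exact absurd (hxy ▸ mem_image_of_mem Prod.snd hq)
        (disjoint_right.1 h2 (mem_image_of_mem Prod.snd hp))
    · rw [hfθ p hp, hfθ q hq, ← mem_extSet.1 hτ p hp, ← mem_extSet.1 hτ q hq] at hxy
      exact τ.injective hxy
  obtain ⟨g, hg⟩ := exists_equiv_extend_of_card_eq (t := (univ : Finset α)) (card_univ).symm
    (subset_univ _) hinj
  refine ⟨g.trans (Equiv.subtypeUnivEquiv fun x => mem_univ x), mem_extSet.2 fun p hp => ?_⟩
  have : ((g p.1 : (univ : Finset α)) : α) = p.2 := by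
    rw [hg p.1 (mem_image_of_mem _ hp)]
    rcases mem_union.1 hp with hp | hp
    · exact hfM p hp
    · exact hfθ p hp
  exact this

lemma factorial_sub_mul_le (n m k : ℕ) (h : m + k ≤ n) :
    (n - m).factorial * (n - k).factorial ≤ n.factorial * (n - (m + k)).factorial := by
  have h1 := Nat.factorial_mul_descFactorial (show k ≤ n - m by omega)
  have h2 := Nat.factorial_mul_descFactorial (show k ≤ n by omega)
  rw [← h1, ← h2, show n - m - k = n - (m + k) by omega]
  have := Nat.descFactorial_le k (Nat.sub_le n m)
  calc _ = (n - (m + k)).factorial * (n - k).factorial * (n - m).descFactorial k := by ring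
    _ ≤ (n - (m + k)).factorial * (n - k).factorial * n.descFactorial k := by gcongr
    _ = _ := by ring

lemma factorial_mul_factorial_sub_le {n m k K R : ℕ} (hk : k ≤ K) (hm : m + k ≤ R) (hR : R < n) :
    (n.factorial : ℝ) * (n - (m + k)).factorial ≤
      ((n : ℝ) / (n - R)) ^ K * ((n - m).factorial * (n - k).factorial) := by
  have h1 := Nat.factorial_mul_descFactorial (show k ≤ n - m by omega)
  have h2 := Nat.factorial_mul_descFactorial (show k ≤ n by omega)
  rw [← h1, ← h2, show n - m - k = n - (m + k) by omega]
  have hR' : (0 : ℝ) < n - R := by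
    have : (R : ℝ) < n := by exact_mod_cast hR
    linarith
  have hq1 : (1 : ℝ) ≤ (n : ℝ) / (n - R) := by
    rw [le_div_iff₀ hR']
    have : (0 : ℝ) ≤ R := by positivity
    linarith
  have h3 : (n.descFactorial k : ℝ) ≤ ((n : ℝ) / (n - R)) ^ K * (n - m).descFactorial k := by
    calc (n.descFactorial k : ℝ) ≤ (n : ℝ) ^ k := by exact_mod_cast Nat.descFactorial_le_pow n k
      _ = ((n : ℝ) / (n - R)) ^ k * (n - R : ℝ) ^ k := by
          rw [← mul_pow, div_mul_cancel₀ _ hR'.ne']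
      _ ≤ ((n : ℝ) / (n - R)) ^ K * (n - m).descFactorial k := by
          gcongr
          calc (n - R : ℝ) ^ k ≤ ((n - m + 1 - k : ℕ) : ℝ) ^ k := by
                gcongr
                rw [sub_le_iff_le_add]
                have : n ≤ n - m + 1 - k + R := by omega
                exact_mod_cast this
            _ ≤ _ := by exact_mod_cast Nat.pow_sub_le_descFactorial (n - m) k
  push_cast
  calc ((n - k).factorial : ℝ) * n.descFactorial k * (n - (m + k)).factorial
      ≤ (n - k).factorial * (((n : ℝ) / (n - R)) ^ K * (n - m).descFactorial k) *
        (n - (m + k)).factorial := by gcongr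
    _ = _ := by ring

/-- The members of `G` contained in the graph of `σ`. -/
def occ (G : Finset (Finset (α × α))) (σ : Equiv.Perm α) : Finset (Finset (α × α)) :=
  G.filter fun θ => σ ∈ extSet θ

/-- The `r`-th binomial moment of `(occ G σ).card` for uniform `σ`. -/
noncomputable def binMoment (G : Finset (Finset (α × α))) (r : ℕ) : ℝ :=
  (∑ σ : Equiv.Perm α, ((occ G σ).card.choose r : ℝ)) / (Fintype.card α).factorial

lemma mem_powersetCard_occ {G T : Finset (Finset (α × α))} {σ : Equiv.Perm α} {r : ℕ} :
    T ∈ powersetCard r (occ G σ) ↔ T ∈ powersetCard r G ∧ σ ∈ extSet (T.biUnion id) := by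
  simp only [mem_powersetCard, occ, mem_extSet, mem_biUnion, id]
  constructor
  · rintro ⟨h1, h2⟩
    refine ⟨⟨h1.trans (filter_subset _ _), h2⟩, ?_⟩
    rintro p ⟨θ, hθ, hp⟩
    exact (mem_filter.1 (h1 hθ)).2 p hp
  · rintro ⟨⟨h1, h2⟩, h3⟩
    exact ⟨fun θ hθ => mem_filter.2 ⟨h1 hθ, fun p hp => h3 p ⟨θ, hθ, hp⟩⟩, h2⟩

lemma sum_choose_occ (G : Finset (Finset (α × α))) (r : ℕ) :
    ∑ σ : Equiv.Perm α, (occ G σ).card.choose r =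
      ∑ T ∈ powersetCard r G, (extSet (T.biUnion id)).card := by
  have h : ∀ σ : Equiv.Perm α, (occ G σ).card.choose r =
      ∑ T ∈ powersetCard r G, if σ ∈ extSet (T.biUnion id) then 1 else 0 := by
    intro σ
    rw [← card_powersetCard, ← card_filter]
    congr 1
    ext T
    rw [mem_powersetCard_occ, mem_filter]
  simp_rw [h]
  rw [sum_comm]
  refine sum_congr rfl fun T _ => ?_
  rw [← card_filter]; congr 1; ext σ; simp

lemma sum_choose_succ_occ (G : Finset (Finset (α × α))) (r : ℕ) :
    ∑ σ : Equiv.Perm α, (occ G σ).card.choose (r + 1) * (r + 1) =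
      ∑ T ∈ powersetCard r G, ∑ θ ∈ G \ T, (extSet (T.biUnion id ∪ θ)).card := by
  have h : ∀ σ : Equiv.Perm α, (occ G σ).card.choose (r + 1) * (r + 1) =
      ∑ T ∈ powersetCard r G, ∑ θ ∈ G \ T,
        if σ ∈ extSet (T.biUnion id ∪ θ) then 1 else 0 := by
    intro σ
    have e1 : ∑ T ∈ powersetCard r (occ G σ), (occ G σ \ T).card =
        (occ G σ).card.choose r * ((occ G σ).card - r) := by
      rw [← card_powersetCard]
      refine sum_const_nat fun T hT => ?_
      rw [mem_powersetCard] at hT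
      rw [card_sdiff_of_subset hT.1, hT.2]
    rw [Nat.choose_succ_right_eq, ← e1]
    have e2 : powersetCard r (occ G σ) =
        (powersetCard r G).filter fun T => σ ∈ extSet (T.biUnion id) := by
      ext T; rw [mem_powersetCard_occ, mem_filter]
    rw [e2, sum_filter]
    refine sum_congr rfl fun T _ => ?_
    rw [← card_filter]
    split_ifs with hT
    · congr 1
      ext θ
      simp only [occ, Finset.mem_sdiff, mem_filter, mem_extSet_union]
      tauto
    · symm
      rw [card_eq_zero, filter_eq_empty_iff]
      intro θ _ h
      exact hT (mem_extSet_union.1 h).1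
  simp_rw [h]
  rw [sum_comm]
  refine sum_congr rfl fun T _ => ?_
  rw [sum_comm]
  refine sum_congr rfl fun θ _ => ?_
  rw [← card_filter]; congr 1; ext σ; simp

/-- Hypotheses on a family `G` of graphs of partial permutations: sizes between `1` and `K`,
members contained in a common permutation are disjoint, and every point is unlikely to be
covered. -/
structure SparseFamily (G : Finset (Finset (α × α))) (K : ℕ) (w : ℝ) : Prop where
  nonempty : ∀ θ ∈ G, θ.Nonempty
  card_le : ∀ θ ∈ G, θ.card ≤ K
  extendable : ∀ θ ∈ G, (extSet θ).Nonempty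
  disjoint : ∀ σ, ∀ θ ∈ occ G σ, ∀ θ' ∈ occ G σ, θ ≠ θ' → Disjoint θ θ'
  fst_le : ∀ v, ∑ θ ∈ G.filter (fun θ => v ∈ θ.image Prod.fst), ((extSet θ).card : ℝ) ≤
    w * (Fintype.card α).factorial
  snd_le : ∀ v, ∑ θ ∈ G.filter (fun θ => v ∈ θ.image Prod.snd), ((extSet θ).card : ℝ) ≤
    w * (Fintype.card α).factorial

lemma sum_card_extSet (G : Finset (Finset (α × α))) :
    ∑ θ ∈ G, ((extSet θ).card : ℝ) = binMoment G 1 * (Fintype.card α).factorial := by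
  rw [binMoment, div_mul_cancel₀ _ (by positivity)]
  have h := sum_choose_succ_occ G 0
  simp only [powersetCard_zero, sum_singleton, biUnion_empty, sdiff_empty, empty_union,
    zero_add, mul_one] at h
  exact_mod_cast h.symm

variable {G : Finset (Finset (α × α))} {K : ℕ} {w : ℝ}

lemma SparseFamily.card_biUnion_le (hG : SparseFamily G K w) {T : Finset (Finset (α × α))}
    {r : ℕ} (hT : T ∈ powersetCard r G) : (T.biUnion id).card ≤ r * K := by
  rw [mem_powersetCard] at hT
  rw [← hT.2]
  exact card_biUnion_le_card_mul _ _ _ fun θ hθ => hG.card_le θ (hT.1 hθ)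

lemma SparseFamily.card_extSet_union_le (hG : SparseFamily G K w)
    {T : Finset (Finset (α × α))} {r : ℕ} (hT : T ∈ powersetCard r G) {θ : Finset (α × α)}
    (hθ : θ ∈ G \ T) (hn : (r + 1) * K < Fintype.card α) :
    (Fintype.card α).factorial * ((extSet (T.biUnion id ∪ θ)).card : ℝ) ≤
      ((Fintype.card α : ℝ) / (Fintype.card α - ((r + 1) * K : ℕ))) ^ K *
        ((extSet (T.biUnion id)).card * (extSet θ).card) := by
  rcases (extSet (T.biUnion id ∪ θ)).eq_empty_or_nonempty with h0 | ⟨σ, hσ⟩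
  · rw [h0]
    have : (((r + 1) * K : ℕ) : ℝ) < Fintype.card α := by exact_mod_cast hn
    have : (0 : ℝ) ≤ Fintype.card α - ((r + 1) * K : ℕ) := by linarith
    simp only [card_empty, Nat.cast_zero, mul_zero]
    positivity
  have hσ' := mem_extSet_union.1 hσ
  rw [Finset.mem_sdiff] at hθ
  have hTo : T ∈ powersetCard r (occ G σ) := mem_powersetCard_occ.2 ⟨hT, hσ'.1⟩
  have hθo : θ ∈ occ G σ := mem_filter.2 ⟨hθ.1, hσ'.2⟩
  have hdisj : Disjoint (T.biUnion id) θ := by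
    rw [disjoint_biUnion_left]
    intro θ' hθ'
    exact hG.disjoint σ θ' ((mem_powersetCard.1 hTo).1 hθ') θ hθo
      (fun h => hθ.2 (h ▸ hθ'))
  rw [card_extSet hσ, card_extSet hσ'.1, card_extSet hσ'.2, card_union_of_disjoint hdisj]
  have h1 := hG.card_biUnion_le hT
  have h2 := hG.card_le θ hθ.1
  exact factorial_mul_factorial_sub_le h2 (by rw [add_mul, one_mul]; omega) hn

lemma card_extSet_mul_le_of_disjoint {M θ : Finset (α × α)} (hM : (extSet M).Nonempty)
    (hθ : (extSet θ).Nonempty) (h1 : Disjoint (M.image Prod.fst) (θ.image Prod.fst))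
    (h2 : Disjoint (M.image Prod.snd) (θ.image Prod.snd)) :
    ((extSet M).card : ℝ) * (extSet θ).card ≤
      (Fintype.card α).factorial * (extSet (M ∪ θ)).card := by
  obtain ⟨σ, hσ⟩ := hM
  obtain ⟨τ, hτ⟩ := hθ
  obtain ⟨ρ, hρ⟩ := exists_mem_extSet_union hσ hτ h1 h2
  have hd : Disjoint M θ := by
    rw [disjoint_left]
    intro p hp hp'
    exact disjoint_left.1 h1 (mem_image_of_mem _ hp) (mem_image_of_mem _ hp')
  have hle : M.card + θ.card ≤ Fintype.card α := by
    rw [← card_union_of_disjoint hd, ← card_image_fst_of_mem_extSet hρ]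
    exact card_le_univ _
  rw [card_extSet hσ, card_extSet hτ, card_extSet hρ, card_union_of_disjoint hd]
  exact_mod_cast factorial_sub_mul_le _ _ _ hle

lemma SparseFamily.sum_bad_le (hG : SparseFamily G K w) (hw : 0 ≤ w) (M : Finset (α × α)) :
    ∑ θ ∈ G.filter (fun θ => ¬ (Disjoint (M.image Prod.fst) (θ.image Prod.fst) ∧
      Disjoint (M.image Prod.snd) (θ.image Prod.snd))), ((extSet θ).card : ℝ) ≤
      2 * M.card * w * (Fintype.card α).factorial := by
  have hsub : G.filter (fun θ => ¬ (Disjoint (M.image Prod.fst) (θ.image Prod.fst) ∧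
      Disjoint (M.image Prod.snd) (θ.image Prod.snd))) ⊆
      (M.image Prod.fst).biUnion (fun v => G.filter (fun θ => v ∈ θ.image Prod.fst)) ∪
      (M.image Prod.snd).biUnion (fun v => G.filter (fun θ => v ∈ θ.image Prod.snd)) := by
    intro θ hθ
    rw [mem_filter, not_and_or, not_disjoint_iff, not_disjoint_iff] at hθ
    rw [mem_union, mem_biUnion, mem_biUnion]
    rcases hθ with ⟨hθ, ⟨v, hv, hv'⟩ | ⟨v, hv, hv'⟩⟩
    · exact Or.inl ⟨v, hv, mem_filter.2 ⟨hθ, hv'⟩⟩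
    · exact Or.inr ⟨v, hv, mem_filter.2 ⟨hθ, hv'⟩⟩
  have hbi : ∀ (S : Finset α) (f : α → Finset (Finset (α × α))), S.card ≤ M.card →
      (∀ v, ∑ θ ∈ f v, ((extSet θ).card : ℝ) ≤ w * (Fintype.card α).factorial) →
      ∑ θ ∈ S.biUnion f, ((extSet θ).card : ℝ) ≤ M.card * w * (Fintype.card α).factorial := by
    intro S f hS hf
    calc ∑ θ ∈ S.biUnion f, ((extSet θ).card : ℝ)
        ≤ ∑ v ∈ S, ∑ θ ∈ f v, ((extSet θ).card : ℝ) :=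
          sum_biUnion_le_sum_sum S f fun _ => by positivity
      _ ≤ ∑ v ∈ S, w * (Fintype.card α).factorial := sum_le_sum fun v _ => hf v
      _ = S.card * (w * (Fintype.card α).factorial) := by rw [sum_const, nsmul_eq_mul]
      _ ≤ M.card * (w * (Fintype.card α).factorial) := by gcongr
      _ = _ := by ring
  calc _ ≤ _ := sum_le_sum_of_subset_of_nonneg hsub fun _ _ _ => by positivity
    _ ≤ _ := sum_union_le_add _ _ fun _ => by positivity
    _ ≤ M.card * w * (Fintype.card α).factorial + M.card * w * (Fintype.card α).factorial :=
        add_le_add (hbi _ _ card_image_le hG.fst_le) (hbi _ _ card_image_le hG.snd_le)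
    _ = _ := by ring

/-- The binomial moments nearly satisfy the recursion of the Poisson distribution. -/
lemma SparseFamily.abs_binMoment_sub_le (hG : SparseFamily G K w) (hw : 0 ≤ w) (r : ℕ)
    (hn : (r + 1) * K < Fintype.card α) :
    |(r + 1) * binMoment G (r + 1) - binMoment G 1 * binMoment G r| ≤
      (2 * (r * K) * w + (((Fintype.card α : ℝ) / (Fintype.card α - ((r + 1) * K : ℕ))) ^ K - 1) *
        binMoment G 1) * binMoment G r := by
  set q : ℝ := ((Fintype.card α : ℝ) / (Fintype.card α - ((r + 1) * K : ℕ))) ^ K with hq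
  set F : ℝ := ((Fintype.card α).factorial : ℝ) with hF
  have hF0 : 0 < F := by positivity
  set lam := binMoment G 1 with hlam
  have hsum : ∑ θ ∈ G, ((extSet θ).card : ℝ) = lam * F := sum_card_extSet G
  have hlow : ∀ T ∈ powersetCard r G, (lam - 2 * (r * K) * w) * (extSet (T.biUnion id)).card ≤
      ∑ θ ∈ G \ T, ((extSet (T.biUnion id ∪ θ)).card : ℝ) := by
    intro T hT
    set M := T.biUnion id with hM
    rcases (extSet M).eq_empty_or_nonempty with h0 | hne
    · rw [h0, card_empty, Nat.cast_zero, mul_zero]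
      exact sum_nonneg fun _ _ => by positivity
    have hMr : (M.card : ℝ) ≤ r * K := by exact_mod_cast hG.card_biUnion_le hT
    have hbad := hG.sum_bad_le hw M
    have hsplit := sum_filter_add_sum_filter_not G (fun θ => Disjoint (M.image Prod.fst)
      (θ.image Prod.fst) ∧ Disjoint (M.image Prod.snd) (θ.image Prod.snd))
      (fun θ => ((extSet θ).card : ℝ))
    rw [hsum] at hsplit
    have hgood : (lam - 2 * (r * K) * w) * F ≤ ∑ θ ∈ G.filter (fun θ => Disjoint (M.image Prod.fst)
      (θ.image Prod.fst) ∧ Disjoint (M.image Prod.snd) (θ.image Prod.snd)),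
        ((extSet θ).card : ℝ) := by
      have : 2 * M.card * w * F ≤ 2 * (r * K) * w * F := by gcongr
      linarith
    refine le_of_mul_le_mul_right ?_ hF0
    calc (lam - 2 * (r * K) * w) * (extSet M).card * F
        = (extSet M).card * ((lam - 2 * (r * K) * w) * F) := by ring
      _ ≤ (extSet M).card * ∑ θ ∈ G.filter (fun θ => Disjoint (M.image Prod.fst)
          (θ.image Prod.fst) ∧ Disjoint (M.image Prod.snd) (θ.image Prod.snd)),
          ((extSet θ).card : ℝ) := by gcongr
      _ ≤ ∑ θ ∈ G.filter (fun θ => Disjoint (M.image Prod.fst)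
          (θ.image Prod.fst) ∧ Disjoint (M.image Prod.snd) (θ.image Prod.snd)),
          F * ((extSet (M ∪ θ)).card : ℝ) := by
          rw [mul_sum]
          refine sum_le_sum fun θ hθ => ?_
          rw [mem_filter] at hθ
          exact card_extSet_mul_le_of_disjoint hne (hG.extendable θ hθ.1) hθ.2.1 hθ.2.2
      _ ≤ ∑ θ ∈ G \ T, F * ((extSet (M ∪ θ)).card : ℝ) := by
          refine sum_le_sum_of_subset_of_nonneg ?_ fun _ _ _ => by positivity
          intro θ hθ
          rw [mem_filter] at hθ
          refine Finset.mem_sdiff.2 ⟨hθ.1, fun hθT => ?_⟩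
          obtain ⟨p, hp⟩ := hG.nonempty θ hθ.1
          exact disjoint_left.1 hθ.2.1
            (mem_image_of_mem _ (mem_biUnion.2 ⟨θ, hθT, hp⟩)) (mem_image_of_mem _ hp)
      _ = _ := by rw [← mul_sum, mul_comm]
  have hup : ∀ T ∈ powersetCard r G, ∑ θ ∈ G \ T, ((extSet (T.biUnion id ∪ θ)).card : ℝ) ≤
      q * lam * (extSet (T.biUnion id)).card := by
    intro T hT
    refine le_of_mul_le_mul_left ?_ hF0
    have hq0 : 0 ≤ q := by
      have : (((r + 1) * K : ℕ) : ℝ) < Fintype.card α := by exact_mod_cast hn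
      have : (0 : ℝ) ≤ Fintype.card α - ((r + 1) * K : ℕ) := by linarith
      positivity
    rw [mul_sum]
    calc _ ≤ ∑ θ ∈ G \ T, q * ((extSet (T.biUnion id)).card * (extSet θ).card) :=
          sum_le_sum fun θ hθ => hG.card_extSet_union_le hT hθ hn
      _ ≤ ∑ θ ∈ G, q * ((extSet (T.biUnion id)).card * (extSet θ).card) :=
          sum_le_sum_of_subset_of_nonneg sdiff_subset fun _ _ _ => by positivity
      _ = q * ((extSet (T.biUnion id)).card * (lam * F)) := by
          rw [← mul_sum, ← mul_sum, hsum]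
      _ = _ := by ring
  have hb : binMoment G r * F = ∑ T ∈ powersetCard r G, ((extSet (T.biUnion id)).card : ℝ) := by
    rw [binMoment, div_mul_cancel₀ _ hF0.ne']
    exact_mod_cast sum_choose_occ G r
  have hb1 : (r + 1) * binMoment G (r + 1) * F =
      ∑ T ∈ powersetCard r G, ∑ θ ∈ G \ T, ((extSet (T.biUnion id ∪ θ)).card : ℝ) := by
    rw [binMoment, mul_assoc, div_mul_cancel₀ _ hF0.ne', mul_comm, sum_mul]
    exact_mod_cast sum_choose_succ_occ G r
  have hL := sum_le_sum hlow
  have hU := sum_le_sum hup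
  rw [← mul_sum, ← hb, ← hb1, ← mul_assoc] at hL
  rw [← mul_sum, ← hb, ← hb1, ← mul_assoc] at hU
  have hL' := le_of_mul_le_mul_right hL hF0
  have hU' := le_of_mul_le_mul_right hU hF0
  have hnn : ∀ s, 0 ≤ binMoment G s := fun s => by
    rw [binMoment]; positivity
  have hq1 : 0 ≤ q - 1 := by
    have h1 : (((r + 1) * K : ℕ) : ℝ) < Fintype.card α := by exact_mod_cast hn
    have h2 : (0 : ℝ) < Fintype.card α - ((r + 1) * K : ℕ) := by linarith
    have h3 : (0 : ℝ) ≤ ((r + 1) * K : ℕ) := by positivity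
    have : 1 ≤ q := one_le_pow₀ (by rw [le_div_iff₀ h2]; linarith)
    linarith
  have h1 : 0 ≤ 2 * (r * K) * w * binMoment G r := mul_nonneg (by positivity) (hnn r)
  have h2 : 0 ≤ (q - 1) * lam * binMoment G r := mul_nonneg (mul_nonneg hq1 (hnn 1)) (hnn r)
  rw [abs_le]
  constructor <;> linarith

end PartialPermutations
section Bonferroni

lemma abs_ite_sub_sum_choose_le (N R : ℕ) :
    |(if N = 0 then (1 : ℝ) else 0) - ∑ i ∈ Finset.range R, (-1) ^ i * (N.choose i : ℝ)| ≤
      N.choose R := by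
  rcases R with _ | r
  · rcases N with _ | m <;> simp
  rcases N with _ | m
  · rw [Finset.sum_range_succ']
    simp
  · have h := Int.alternating_sum_range_choose_eq_choose (n := m) (m := r)
    have h' : ∑ i ∈ Finset.range (r + 1), (-1) ^ i * ((m + 1).choose i : ℝ) =
        (-1) ^ r * (m.choose r : ℝ) := by exact_mod_cast h
    rw [h', if_neg (by omega), zero_sub, abs_neg, abs_mul, abs_pow, abs_neg, abs_one, one_pow,
      one_mul, Nat.abs_cast, Nat.choose_succ_succ]
    push_cast
    have : (0 : ℝ) ≤ m.choose (r + 1) := by positivity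
    linarith

lemma abs_card_occ_eq_empty_sub_sum_binMoment_le {α : Type*} [Fintype α] [DecidableEq α]
    (G : Finset (Finset (α × α))) (R : ℕ) :
    |((Finset.univ.filter fun σ : Equiv.Perm α => occ G σ = ∅).card : ℝ) /
        (Fintype.card α).factorial - ∑ i ∈ Finset.range R, (-1) ^ i * binMoment G i| ≤
      binMoment G R := by
  have hF : (0 : ℝ) < (Fintype.card α).factorial := by positivity
  have h : ((Finset.univ.filter fun σ : Equiv.Perm α => occ G σ = ∅).card : ℝ) /
        (Fintype.card α).factorial - ∑ i ∈ Finset.range R, (-1) ^ i * binMoment G i =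
      (∑ σ : Equiv.Perm α, ((if (occ G σ).card = 0 then (1 : ℝ) else 0) -
        ∑ i ∈ Finset.range R, (-1) ^ i * ((occ G σ).card.choose i : ℝ))) /
        (Fintype.card α).factorial := by
    rw [Finset.sum_sub_distrib, sub_div, Finset.sum_comm]
    congr 1
    · simp [Finset.card_eq_zero]
    · rw [Finset.sum_div]
      refine Finset.sum_congr rfl fun i _ => ?_
      rw [binMoment, ← Finset.mul_sum, mul_div_assoc]
  rw [h, abs_div, abs_of_pos hF, binMoment]
  gcongr
  exact (Finset.abs_sum_le_sum_abs _ _).trans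
    (Finset.sum_le_sum fun σ _ => abs_ite_sub_sum_choose_le _ _)

lemma abs_exp_neg_sub_sum_le {x : ℝ} (hx : 0 ≤ x) {R : ℕ} (hR : 2 * x ≤ R + 1) :
    |Real.exp (-x) - ∑ i ∈ Finset.range R, (-1) ^ i * (x ^ i / i.factorial)| ≤
      x ^ R / R.factorial * 2 := by
  have h := Complex.exp_bound' (x := ((-x : ℝ) : ℂ)) (n := R) (by
    rw [Complex.norm_real, norm_neg, Real.norm_of_nonneg hx, div_le_div_iff₀ (by positivity)
      (by norm_num)]
    push_cast; linarith)
  rw [Complex.norm_real, norm_neg, Real.norm_of_nonneg hx] at h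
  have e : Complex.exp ((-x : ℝ) : ℂ) - ∑ m ∈ Finset.range R, ((-x : ℝ) : ℂ) ^ m / m.factorial =
      ((Real.exp (-x) - ∑ i ∈ Finset.range R, (-1) ^ i * (x ^ i / i.factorial) : ℝ) : ℂ) := by
    push_cast
    congr 1
    refine Finset.sum_congr rfl fun i _ => ?_
    rw [neg_pow]; ring
  rwa [e, Complex.norm_real] at h

lemma tendsto_sub_pow_div_factorial {b ε : ℕ → ℕ → ℝ} {L : ℝ} (h0 : ∀ n, b n 0 = 1)
    (hb : ∀ n r, 0 ≤ b n r) (hL : ∀ᶠ n in atTop, b n 1 ≤ L)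
    (hε : ∀ r, Tendsto (fun n => ε n r) atTop (nhds 0))
    (hrec : ∀ r, ∀ᶠ n in atTop, |(r + 1) * b n (r + 1) - b n 1 * b n r| ≤ ε n r * b n r) (r : ℕ) :
    Tendsto (fun n => b n r - b n 1 ^ r / r.factorial) atTop (nhds 0) := by
  induction r with
  | zero => simp [h0]
  | succ r ih =>
    have hlim : Tendsto (fun n => |ε n r| * (|b n r - b n 1 ^ r / r.factorial| + L ^ r) +
        L * |b n r - b n 1 ^ r / r.factorial|) atTop (nhds 0) := by
      have h1 := (((hε r).abs).mul (ih.abs.add_const (L ^ r))).add (ih.abs.const_mul L)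
      simpa using h1
    refine squeeze_zero_norm' ?_ hlim
    filter_upwards [hL, hrec r] with n hn hr
    have hf : (1 : ℝ) ≤ r.factorial := by exact_mod_cast r.factorial_pos
    set d := b n r - b n 1 ^ r / r.factorial with hd
    have hbr : b n r ≤ |d| + L ^ r := by
      have h1 : b n 1 ^ r / r.factorial ≤ L ^ r :=
        (div_le_self (pow_nonneg (hb n 1) r) hf).trans (pow_le_pow_left₀ (hb n 1) hn r)
      linarith [le_abs_self d]
    have key : (r + 1) * (b n (r + 1) - b n 1 ^ (r + 1) / (r + 1).factorial) =
        ((r + 1) * b n (r + 1) - b n 1 * b n r) + b n 1 * d := by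
      rw [hd, Nat.factorial_succ]; push_cast; field_simp; ring
    rw [Real.norm_eq_abs]
    calc |b n (r + 1) - b n 1 ^ (r + 1) / (r + 1).factorial|
        ≤ (r + 1) * |b n (r + 1) - b n 1 ^ (r + 1) / (r + 1).factorial| :=
          le_mul_of_one_le_left (abs_nonneg _) (by linarith [(Nat.cast_nonneg r : (0:ℝ) ≤ r)])
      _ = |((r + 1) * b n (r + 1) - b n 1 * b n r) + b n 1 * d| := by
          rw [← key, abs_mul, abs_of_nonneg (by positivity : (0 : ℝ) ≤ r + 1)]
      _ ≤ |(r + 1) * b n (r + 1) - b n 1 * b n r| + |b n 1 * d| := abs_add_le _ _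
      _ ≤ |ε n r| * (|d| + L ^ r) + L * |d| := by
          rw [abs_mul, abs_of_nonneg (hb n 1)]
          gcongr
          exact hr.trans (mul_le_mul (le_abs_self _) hbr (hb n r) (abs_nonneg _))

lemma tendsto_prob_occ_eq_empty_sub_exp {G : (n : ℕ) → Finset (Finset (Fin n × Fin n))} {K : ℕ}
    {w : ℕ → ℝ} {L : ℝ} (hG : ∀ᶠ n in atTop, SparseFamily (G n) K (w n)) (hw0 : ∀ n, 0 ≤ w n)
    (hw : Tendsto w atTop (nhds 0)) (hL : ∀ᶠ n in atTop, binMoment (G n) 1 ≤ L) :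
    Tendsto (fun n => ((Finset.univ.filter fun σ : Equiv.Perm (Fin n) =>
      occ (G n) σ = ∅).card : ℝ) / n.factorial - Real.exp (-binMoment (G n) 1))
      atTop (nhds 0) := by
  have hnn : ∀ n r, 0 ≤ binMoment (G n) r := fun n r => by rw [binMoment]; positivity
  have hL0 : 0 ≤ L := by
    obtain ⟨n, hn⟩ := hL.exists
    exact (hnn n 1).trans hn
  have hmom := fun r => tendsto_sub_pow_div_factorial (b := fun n r => binMoment (G n) r)
    (ε := fun n r => 2 * (r * K) * w n +
      (((n : ℝ) / (n - ((r + 1) * K : ℕ))) ^ K - 1) * L) (L := L)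
    (fun n => by
      simp only [binMoment, Nat.choose_zero_right, Nat.cast_one, Finset.sum_const,
        Finset.card_univ, Fintype.card_perm, nsmul_eq_mul, mul_one]
      exact div_self (by positivity)) hnn hL
    (fun r => by
      have h1 : Tendsto (fun n : ℕ => (n : ℝ) / (n - ((r + 1) * K : ℕ))) atTop (nhds 1) := by
        have := (tendsto_natCast_div_add_atTop (𝕜 := ℝ) (-(((r + 1) * K : ℕ) : ℝ)))
        simpa only [← sub_eq_add_neg] using this
      have h2 := (hw.const_mul (2 * (r * K : ℝ))).add (((h1.pow K).sub_const 1).mul_const L)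
      simpa using h2)
    (fun r => by
      filter_upwards [hG, hL, eventually_gt_atTop ((r + 1) * K)] with n hn hl hgt
      refine (hn.abs_binMoment_sub_le (hw0 n) r (by simpa using hgt)).trans ?_
      rw [Fintype.card_fin]
      refine mul_le_mul_of_nonneg_right ?_ (hnn n r)
      gcongr
      have h1 : (((r + 1) * K : ℕ) : ℝ) < n := by exact_mod_cast hgt
      have h3 : (0 : ℝ) ≤ ((r + 1) * K : ℕ) := by positivity
      exact sub_nonneg.2 (one_le_pow₀ (by rw [le_div_iff₀ (by linarith)]; linarith))) r
  rw [Metric.tendsto_atTop']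
  intro η hη
  obtain ⟨R, hR1, hR2⟩ : ∃ R : ℕ, 2 * L ≤ R + 1 ∧ 3 * (L ^ R / R.factorial) < η / 2 := by
    have h1 := ((FloorSemiring.tendsto_pow_div_factorial_atTop L).const_mul 3)
    rw [mul_zero] at h1
    have h2 := h1.eventually (gt_mem_nhds (half_pos hη))
    obtain ⟨R, h3, h4⟩ := (h2.and (eventually_ge_atTop ⌈2 * L⌉₊)).exists
    exact ⟨R, by linarith [Nat.ceil_le.1 h4], h3⟩
  have hsum : Tendsto (fun n => ∑ i ∈ Finset.range (R + 1),
      |binMoment (G n) i - binMoment (G n) 1 ^ i / i.factorial|) atTop (nhds 0) := by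
    have := tendsto_finsetSum (Finset.range (R + 1)) fun i _ => (hmom i).abs
    simpa using this
  have hev := hsum.eventually (gt_mem_nhds (half_pos hη))
  suffices h : ∀ᶠ n : ℕ in atTop, dist (((Finset.univ.filter fun σ : Equiv.Perm (Fin n) =>
      occ (G n) σ = ∅).card : ℝ) / n.factorial - Real.exp (-binMoment (G n) 1)) 0 < η by
    obtain ⟨N, hN⟩ := eventually_atTop.1 h
    exact ⟨N, fun n hn => hN n hn.le⟩
  filter_upwards [hev, hL] with n hn hl
  have hB := abs_card_occ_eq_empty_sub_sum_binMoment_le (G n) R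
  rw [Fintype.card_fin] at hB
  have hE := abs_exp_neg_sub_sum_le (hnn n 1) (R := R) (by linarith)
  have hM : |∑ i ∈ Finset.range R, (-1) ^ i * binMoment (G n) i -
      ∑ i ∈ Finset.range R, (-1) ^ i * (binMoment (G n) 1 ^ i / i.factorial)| ≤
      ∑ i ∈ Finset.range R, |binMoment (G n) i - binMoment (G n) 1 ^ i / i.factorial| := by
    rw [← Finset.sum_sub_distrib]
    refine (Finset.abs_sum_le_sum_abs _ _).trans_eq (Finset.sum_congr rfl fun i _ => ?_)
    rw [← mul_sub, abs_mul, abs_pow, abs_neg, abs_one, one_pow, one_mul]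
  have hpow : binMoment (G n) 1 ^ R / R.factorial ≤ L ^ R / R.factorial := by
    have := pow_le_pow_left₀ (hnn n 1) hl R
    gcongr
  rw [Finset.sum_range_succ] at hn
  have h5 := le_abs_self (binMoment (G n) R - binMoment (G n) 1 ^ R / R.factorial)
  rw [Real.dist_0_eq_abs]
  rw [abs_lt]
  rw [abs_le] at hB hE hM
  constructor <;> linarith [hB.1, hB.2, hE.1, hE.2, hM.1, hM.2]

end Bonferroni
section RestrictedGraph

open Finset

variable {α : Type*} [DecidableEq α]

/-- The graph of `σ` restricted to `X`. -/
def graphOn (σ : Equiv.Perm α) (X : Finset α) : Finset (α × α) := X.image fun x => (x, σ x)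

lemma mem_graphOn {σ : Equiv.Perm α} {X : Finset α} {p : α × α} :
    p ∈ graphOn σ X ↔ p.1 ∈ X ∧ σ p.1 = p.2 := by
  rw [graphOn, mem_image]
  constructor
  · rintro ⟨x, hx, rfl⟩; exact ⟨hx, rfl⟩
  · rintro ⟨h1, h2⟩; exact ⟨p.1, h1, Prod.ext rfl h2⟩

lemma image_fst_graphOn (σ : Equiv.Perm α) (X : Finset α) :
    (graphOn σ X).image Prod.fst = X := by
  ext x; simp [graphOn]

lemma image_snd_graphOn (σ : Equiv.Perm α) (X : Finset α) :
    (graphOn σ X).image Prod.snd = X.image σ := by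
  ext x; simp [graphOn]

lemma graphOn_injective (σ : Equiv.Perm α) : Function.Injective (graphOn σ) := fun X Y h => by
  rw [← image_fst_graphOn σ X, h, image_fst_graphOn]

lemma card_graphOn (σ : Equiv.Perm α) (X : Finset α) : (graphOn σ X).card = X.card :=
  card_image_of_injective _ fun _ _ h => (Prod.ext_iff.1 h).1

end RestrictedGraph

section CommonOrbits

open Finset

variable {α : Type*} [Fintype α] [DecidableEq α]

/-- The orbits of the group generated by `a` and `b`, as minimal nonempty sets invariant under
both. -/
def orbSets (a b : Equiv.Perm α) : Finset (Finset α) :=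
  univ.filter fun X => X.Nonempty ∧ (∀ x ∈ X, a x ∈ X ∧ b x ∈ X) ∧
    ∀ Z ⊆ X, Z.Nonempty → (∀ z ∈ Z, a z ∈ Z ∧ b z ∈ Z) → Z = X

lemma mem_orbSets {a b : Equiv.Perm α} {X : Finset α} :
    X ∈ orbSets a b ↔ X.Nonempty ∧ (∀ x ∈ X, a x ∈ X ∧ b x ∈ X) ∧
      ∀ Z ⊆ X, Z.Nonempty → (∀ z ∈ Z, a z ∈ Z ∧ b z ∈ Z) → Z = X := by
  simp [orbSets]

lemma mem_orbSets_congr {a b b' : Equiv.Perm α} {X : Finset α} (h : ∀ x ∈ X, b x = b' x)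
    (hX : X ∈ orbSets a b) : X ∈ orbSets a b' := by
  rw [mem_orbSets] at hX ⊢
  refine ⟨hX.1, fun x hx => ?_, fun Z hZX hZ hinv => hX.2.2 Z hZX hZ fun z hz => ?_⟩
  · rw [← h x hx]; exact hX.2.1 x hx
  · rw [h z (hZX hz)]; exact hinv z hz

lemma eq_of_mem_orbSets {a b : Equiv.Perm α} {X Y : Finset α} (hX : X ∈ orbSets a b)
    (hY : Y ∈ orbSets a b) (h : (X ∩ Y).Nonempty) : X = Y := by
  rw [mem_orbSets] at hX hY
  have hinv : ∀ z ∈ X ∩ Y, a z ∈ X ∩ Y ∧ b z ∈ X ∩ Y := fun z hz => by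
    rw [mem_inter] at hz
    exact ⟨mem_inter.2 ⟨(hX.2.1 z hz.1).1, (hY.2.1 z hz.2).1⟩,
      mem_inter.2 ⟨(hX.2.1 z hz.1).2, (hY.2.1 z hz.2).2⟩⟩
  rw [← hX.2.2 _ inter_subset_left h hinv]
  exact hY.2.2 _ inter_subset_right h hinv

lemma mem_extSet_graphOn {σ τ : Equiv.Perm α} {X : Finset α} :
    τ ∈ extSet (graphOn σ X) ↔ ∀ x ∈ X, τ x = σ x := by
  rw [mem_extSet]
  constructor
  · exact fun h x hx => h (x, σ x) (mem_graphOn.2 ⟨hx, rfl⟩)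
  · intro h p hp
    rw [mem_graphOn] at hp
    rw [h _ hp.1, hp.2]

/-- The orbits of size at most `K` of the group generated by `π` and `σ⁻¹ * π' * σ`. -/
def shortOrbits (π π' : Equiv.Perm α) (K : ℕ) (σ : Equiv.Perm α) : Finset (Finset α) :=
  (orbSets π (σ⁻¹ * π' * σ)).filter fun X => X.card ≤ K

/-- The restrictions of permutations `σ` to the orbits of size at most `K` of the group generated
by `π` and `σ⁻¹ * π' * σ`. -/
def orbGraphs (π π' : Equiv.Perm α) (K : ℕ) : Finset (Finset (α × α)) :=
  univ.biUnion fun σ => (shortOrbits π π' K σ).image (graphOn σ)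

lemma mem_shortOrbits_of_eqOn {π π' : Equiv.Perm α} {K : ℕ} {σ τ : Equiv.Perm α} {X : Finset α}
    (h : ∀ x ∈ X, τ x = σ x) (hX : X ∈ shortOrbits π π' K σ) : X ∈ shortOrbits π π' K τ := by
  rw [shortOrbits, mem_filter] at hX ⊢
  refine ⟨mem_orbSets_congr (fun x hx => ?_) hX.1, hX.2⟩
  have hb := ((mem_orbSets.1 hX.1).2.1 x hx).2
  apply τ.injective
  rw [h _ hb]
  simp [h x hx]

lemma occ_orbGraphs (π π' : Equiv.Perm α) (K : ℕ) (σ : Equiv.Perm α) :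
    occ (orbGraphs π π' K) σ = (shortOrbits π π' K σ).image (graphOn σ) := by
  ext θ
  rw [occ, mem_filter, orbGraphs, mem_biUnion, mem_image]
  constructor
  · rintro ⟨⟨τ, -, hτ⟩, h⟩
    obtain ⟨X, hX, rfl⟩ := mem_image.1 hτ
    rw [mem_extSet_graphOn] at h
    refine ⟨X, mem_shortOrbits_of_eqOn h hX, ?_⟩
    exact image_congr fun x hx => Prod.ext rfl (h x hx)
  · rintro ⟨X, hX, rfl⟩
    exact ⟨⟨σ, mem_univ _, mem_image_of_mem _ hX⟩, mem_extSet_graphOn.2 fun _ _ => rfl⟩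

lemma card_occ_orbGraphs (π π' : Equiv.Perm α) (K : ℕ) (σ : Equiv.Perm α) :
    (occ (orbGraphs π π' K) σ).card = (shortOrbits π π' K σ).card := by
  rw [occ_orbGraphs, card_image_of_injective _ (graphOn_injective σ)]

lemma card_filter_image_eq_mul_choose {X Y : Finset α} (h : X.card = Y.card) :
    (univ.filter fun σ : Equiv.Perm α => X.image σ = Y).card * (Fintype.card α).choose X.card =
      (Fintype.card α).factorial := by
  have hconst : ∀ Z ∈ powersetCard X.card (univ : Finset α),
      (univ.filter fun σ : Equiv.Perm α => X.image σ = Z).card =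
        (univ.filter fun σ : Equiv.Perm α => X.image σ = Y).card := by
    intro Z hZ
    have hc : Z.card = Y.card := (mem_powersetCard.1 hZ).2.trans h
    set τ : Equiv.Perm α := (Finset.equivOfCardEq hc).extendSubtype with hτ
    have hτZ : Z.image τ = Y := by
      refine eq_of_subset_of_card_le (fun y hy => ?_) ?_
      · obtain ⟨z, hz, rfl⟩ := mem_image.1 hy
        rw [hτ, Equiv.extendSubtype_apply_of_mem _ z hz]
        exact (Finset.equivOfCardEq hc ⟨z, hz⟩).2
      · rw [card_image_of_injective _ τ.injective, hc]
    refine card_bij' (fun σ _ => τ * σ) (fun σ _ => τ⁻¹ * σ) ?_ ?_ ?_ ?_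
    · intro σ hσ
      simp only [mem_filter, mem_univ, true_and] at hσ ⊢
      rw [← hτZ, ← hσ, image_image]; rfl
    · intro σ hσ
      simp only [mem_filter, mem_univ, true_and] at hσ ⊢
      apply image_injective τ.injective
      rw [hτZ, ← hσ, image_image]
      congr 1
      funext x
      simp
    · intro σ _; simp
    · intro σ _; simp
  have h1 := card_eq_sum_card_fiberwise (s := (univ : Finset (Equiv.Perm α)))
    (t := powersetCard X.card (univ : Finset α)) (f := fun σ : Equiv.Perm α => X.image σ)
    (fun σ _ => by
      simp [mem_powersetCard, card_image_of_injective _ σ.injective])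
  rw [sum_congr rfl hconst, sum_const, card_univ, Fintype.card_perm, card_powersetCard, card_univ,
    smul_eq_mul, mul_comm] at h1
  exact h1.symm

lemma sum_card_filter_image_mem {S S' : Finset (Finset α)} {k : ℕ} (hS : ∀ X ∈ S, X.card = k)
    (hS' : ∀ X ∈ S', X.card = k) :
    ∑ σ : Equiv.Perm α, ((S.filter fun X => X.image σ ∈ S').card : ℝ) =
      S.card * S'.card / (Fintype.card α).choose k * (Fintype.card α).factorial := by
  have h1 : ∑ σ : Equiv.Perm α, (S.filter fun X => X.image σ ∈ S').card =
      ∑ X ∈ S, ∑ Y ∈ S', (univ.filter fun σ : Equiv.Perm α => X.image σ = Y).card := by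
    simp_rw [card_filter]
    rw [sum_comm]
    refine sum_congr rfl fun X _ => ?_
    rw [sum_comm]
    refine sum_congr rfl fun σ _ => ?_
    rw [sum_ite_eq]
  have h2 : ∀ X ∈ S, ∀ Y ∈ S', ((univ.filter fun σ : Equiv.Perm α => X.image σ = Y).card : ℝ) =
      (Fintype.card α).factorial / (Fintype.card α).choose k := by
    intro X hX Y hY
    have h3 := card_filter_image_eq_mul_choose ((hS X hX).trans (hS' Y hY).symm)
    rw [hS X hX] at h3
    have h4 : 0 < (Fintype.card α).choose k := by
      apply Nat.choose_pos
      rw [← hS X hX]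
      exact card_le_univ X
    rw [eq_div_iff (by positivity)]
    exact_mod_cast h3
  have h5 : ∑ σ : Equiv.Perm α, ((S.filter fun X => X.image σ ∈ S').card : ℝ) =
      ∑ X ∈ S, ∑ Y ∈ S', ((univ.filter fun σ : Equiv.Perm α => X.image σ = Y).card : ℝ) := by
    exact_mod_cast h1
  rw [h5, sum_congr rfl fun X hX => sum_congr rfl (h2 X hX)]
  simp only [sum_const, nsmul_eq_mul]
  ring

lemma image_mem_invSets_of_mem_orbSets {π π' σ : Equiv.Perm α} {X : Finset α}
    (hX : X ∈ orbSets π (σ⁻¹ * π' * σ)) : X ∈ invSets π ∧ X.image σ ∈ invSets π' := by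
  rw [mem_orbSets] at hX
  refine ⟨mem_invSets.2 fun x hx => (hX.2.1 x hx).1, mem_invSets.2 fun y hy => ?_⟩
  obtain ⟨x, hx, rfl⟩ := mem_image.1 hy
  exact mem_image.2 ⟨_, (hX.2.1 x hx).2, by simp⟩

lemma sum_card_filter_orbSets_le (π π' : Equiv.Perm α) (k : ℕ) (p p' : Finset α → Prop)
    [DecidablePred p] [DecidablePred p'] :
    ∑ σ : Equiv.Perm α, (((orbSets π (σ⁻¹ * π' * σ)).filter fun X =>
        X.card = k ∧ p X ∧ p' (X.image σ)).card : ℝ) ≤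
      ((invSets π).filter fun X => p X ∧ X.card = k).card *
        ((invSets π').filter fun X => p' X ∧ X.card = k).card /
        (Fintype.card α).choose k * (Fintype.card α).factorial := by
  rw [← sum_card_filter_image_mem (k := k) (fun X hX => (mem_filter.1 hX).2.2)
    (fun X hX => (mem_filter.1 hX).2.2)]
  refine sum_le_sum fun σ _ => ?_
  norm_cast
  refine card_le_card fun X hX => ?_
  simp only [mem_filter] at hX ⊢
  have h := image_mem_invSets_of_mem_orbSets hX.1
  exact ⟨⟨h.1, hX.2.2.1, hX.2.1⟩, h.2, hX.2.2.2,
    (card_image_of_injective _ σ.injective).trans hX.2.1⟩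

lemma sum_card_orbSets_le (π π' : Equiv.Perm α) (k : ℕ) :
    ∑ σ : Equiv.Perm α, (((orbSets π (σ⁻¹ * π' * σ)).filter fun X => X.card = k).card : ℝ) ≤
      invCount π k * invCount π' k / (Fintype.card α).choose k * (Fintype.card α).factorial := by
  simpa [invCount] using sum_card_filter_orbSets_le π π' k (fun _ => True) (fun _ => True)

lemma card_shortOrbits_eq_sum (π π' : Equiv.Perm α) (K : ℕ) (σ : Equiv.Perm α)
    (p : Finset α → Prop) [DecidablePred p] :
    ((shortOrbits π π' K σ).filter p).card =
      ∑ k ∈ Icc 1 K, ((orbSets π (σ⁻¹ * π' * σ)).filter fun X => X.card = k ∧ p X).card := by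
  rw [card_eq_sum_card_fiberwise (f := Finset.card) (t := Icc 1 K)]
  · refine sum_congr rfl fun k hk => ?_
    congr 1
    ext X
    simp only [shortOrbits, mem_filter]
    rw [mem_Icc] at hk
    constructor
    · rintro ⟨⟨⟨h1, h2⟩, h3⟩, h4⟩; exact ⟨h1, h4, h3⟩
    · rintro ⟨h1, h2, h3⟩; exact ⟨⟨⟨h1, h2.le.trans hk.2⟩, h3⟩, h2⟩
  · intro X hX
    simp only [shortOrbits, coe_filter, Set.mem_ofPred_eq, mem_filter] at hX
    simp only [coe_Icc, Set.mem_Icc]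
    exact ⟨card_pos.2 (mem_orbSets.1 hX.1.1).1, hX.1.2⟩

lemma sum_filter_orbGraphs_card_extSet (π π' : Equiv.Perm α) (K : ℕ)
    (q : Finset (α × α) → Prop) [DecidablePred q] :
    ∑ θ ∈ (orbGraphs π π' K).filter q, ((extSet θ).card : ℝ) =
      ∑ σ : Equiv.Perm α, (((shortOrbits π π' K σ).filter fun X => q (graphOn σ X)).card : ℝ) := by
  have h : ∀ σ : Equiv.Perm α, ((shortOrbits π π' K σ).filter fun X => q (graphOn σ X)).card =
      ∑ θ ∈ (orbGraphs π π' K).filter q, if σ ∈ extSet θ then 1 else 0 := by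
    intro σ
    rw [← card_filter, filter_comm, ← occ, occ_orbGraphs, filter_image,
      card_image_of_injective _ (graphOn_injective σ)]
  simp_rw [h]
  push_cast
  rw [sum_comm]
  refine sum_congr rfl fun θ _ => ?_
  simp

lemma sparseFamily_orbGraphs {π π' : Equiv.Perm α} {K : ℕ} {w : ℝ}
    (h : ∀ v, ∑ k ∈ Icc 1 K, (invCountAt π v k * invCount π' k : ℝ) /
      (Fintype.card α).choose k ≤ w)
    (h' : ∀ v, ∑ k ∈ Icc 1 K, (invCount π k * invCountAt π' v k : ℝ) /
      (Fintype.card α).choose k ≤ w) : SparseFamily (orbGraphs π π' K) K w where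
  nonempty θ hθ := by
    simp only [orbGraphs, mem_biUnion, mem_image, shortOrbits, mem_filter] at hθ
    obtain ⟨σ, -, X, hX, rfl⟩ := hθ
    exact (mem_orbSets.1 hX.1).1.image _
  card_le θ hθ := by
    simp only [orbGraphs, mem_biUnion, mem_image, shortOrbits, mem_filter] at hθ
    obtain ⟨σ, -, X, hX, rfl⟩ := hθ
    rw [card_graphOn]; exact hX.2
  extendable θ hθ := by
    simp only [orbGraphs, mem_biUnion, mem_image] at hθ
    obtain ⟨σ, -, X, hX, rfl⟩ := hθ
    exact ⟨σ, mem_extSet_graphOn.2 fun _ _ => rfl⟩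
  disjoint σ θ hθ θ' hθ' hne := by
    rw [occ_orbGraphs, mem_image] at hθ hθ'
    obtain ⟨X, hX, rfl⟩ := hθ
    obtain ⟨Y, hY, rfl⟩ := hθ'
    rw [disjoint_left]
    intro p hp hp'
    rw [mem_graphOn] at hp hp'
    rw [shortOrbits, mem_filter] at hX hY
    exact hne (congrArg _ (eq_of_mem_orbSets hX.1 hY.1 ⟨p.1, mem_inter.2 ⟨hp.1, hp'.1⟩⟩))
  fst_le v := by
    rw [sum_filter_orbGraphs_card_extSet]
    refine le_trans ?_ (mul_le_mul_of_nonneg_right (h v) (by positivity))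
    simp_rw [image_fst_graphOn, card_shortOrbits_eq_sum]
    push_cast
    rw [sum_comm, sum_mul]
    refine sum_le_sum fun k _ => ?_
    simpa [invCount, invCountAt] using
      sum_card_filter_orbSets_le π π' k (fun X => v ∈ X) (fun _ => True)
  snd_le v := by
    rw [sum_filter_orbGraphs_card_extSet]
    refine le_trans ?_ (mul_le_mul_of_nonneg_right (h' v) (by positivity))
    simp_rw [image_snd_graphOn, card_shortOrbits_eq_sum]
    push_cast
    rw [sum_comm, sum_mul]
    refine sum_le_sum fun k _ => ?_
    simpa only [invCount, invCountAt, true_and] using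
      sum_card_filter_orbSets_le π π' k (fun _ => True) (fun X => v ∈ X)

end CommonOrbits
section SmallOrbits

lemma orbit_closure_subset {n : ℕ} {a b : Equiv.Perm (Fin n)} {Z : Finset (Fin n)}
    (hZ : ∀ z ∈ Z, a z ∈ Z ∧ b z ∈ Z) {z : Fin n} (hz : z ∈ Z) :
    MulAction.orbit (Subgroup.closure {a, b}) z ⊆ Z := by
  have key : ∀ g ∈ Subgroup.closure {a, b}, Z.image g = Z := by
    intro g hg
    induction hg using Subgroup.closure_induction with
    | mem g hg =>
      refine Finset.eq_of_subset_of_card_le (fun y hy => ?_)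
        (Finset.card_image_of_injective _ g.injective).ge
      obtain ⟨x, hx, rfl⟩ := Finset.mem_image.1 hy
      rcases hg with rfl | rfl
      · exact (hZ x hx).1
      · exact (hZ x hx).2
    | one => simp
    | mul g h _ _ hg hh =>
      rw [Equiv.Perm.coe_mul, ← Finset.image_image, hh, hg]
    | inv g _ hg =>
      conv_lhs => rw [← hg, Finset.image_image]
      ext x; simp
  rintro y ⟨g, rfl⟩
  have := Finset.mem_image_of_mem (g : Equiv.Perm (Fin n)) hz
  rw [key g g.2] at this
  exact this

lemma mem_orbSets_iff_exists_orbit {n : ℕ} {a b : Equiv.Perm (Fin n)} {X : Finset (Fin n)} :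
    X ∈ orbSets a b ↔ ∃ x, (X : Set (Fin n)) = MulAction.orbit (Subgroup.closure {a, b}) x := by
  classical
  have hcl : ∀ x y, y ∈ MulAction.orbit (Subgroup.closure {a, b}) x →
      a y ∈ MulAction.orbit (Subgroup.closure {a, b}) x ∧
      b y ∈ MulAction.orbit (Subgroup.closure {a, b}) x := by
    intro x y hy
    have h1 : a ∈ Subgroup.closure {a, b} := Subgroup.subset_closure (by simp)
    have h2 : b ∈ Subgroup.closure {a, b} := Subgroup.subset_closure (by simp)
    exact ⟨MulAction.mem_orbit_of_mem_orbit (⟨a, h1⟩ : Subgroup.closure {a, b}) hy,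
      MulAction.mem_orbit_of_mem_orbit (⟨b, h2⟩ : Subgroup.closure {a, b}) hy⟩
  rw [mem_orbSets]
  constructor
  · rintro ⟨⟨x, hx⟩, hinv, hmin⟩
    refine ⟨x, ?_⟩
    have h := hmin (Finset.univ.filter (· ∈ MulAction.orbit (Subgroup.closure {a, b}) x))
      (fun y hy => orbit_closure_subset hinv hx (Finset.mem_filter.1 hy).2)
      ⟨x, by simp⟩ (fun z hz => by simpa using hcl x z (Finset.mem_filter.1 hz).2)
    rw [← h]
    ext y; simp
  · rintro ⟨x, hx⟩
    have hmem : ∀ y, y ∈ X ↔ y ∈ MulAction.orbit (Subgroup.closure {a, b}) x := fun y => by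
      rw [← hx, Finset.mem_coe]
    refine ⟨⟨x, (hmem x).2 (MulAction.mem_orbit_self x)⟩, fun y hy => ?_,
      fun Z hZX ⟨z, hz⟩ hinv => ?_⟩
    · rw [hmem, hmem]; exact hcl x y ((hmem y).1 hy)
    · refine Finset.Subset.antisymm hZX fun y hy => ?_
      have hzx := MulAction.orbit_eq_iff.2 ((hmem z).1 (hZX hz))
      have := orbit_closure_subset hinv hz
      rw [hzx] at this
      exact this ((hmem y).1 hy)

lemma smallOrbitCount_eq_card {n : ℕ} (a b : Equiv.Perm (Fin n)) :
    smallOrbitCount a b = ((orbSets a b).filter fun X => 2 * X.card ≤ n).card := by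
  have h : {X : Set (Fin n) | (∃ x : Fin n, X = MulAction.orbit (Subgroup.closure {a, b}) x) ∧
      2 * Nat.card X ≤ n} = (fun X : Finset (Fin n) => (X : Set (Fin n))) ''
        (((orbSets a b).filter fun X => 2 * X.card ≤ n : Finset (Finset (Fin n))) :
          Set (Finset (Fin n))) := by
    classical
    ext X
    simp only [Set.mem_ofPred_eq, Set.mem_image, Finset.coe_filter]
    constructor
    · rintro ⟨⟨x, hx⟩, hc⟩
      refine ⟨X.toFinset, ⟨mem_orbSets_iff_exists_orbit.2 ⟨x, by simpa using hx⟩, ?_⟩, by simp⟩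
      rwa [Set.toFinset_card, ← Nat.card_eq_fintype_card]
    · rintro ⟨Y, ⟨hY, hc⟩, rfl⟩
      exact ⟨mem_orbSets_iff_exists_orbit.1 hY, by simpa using hc⟩
  rw [smallOrbitCount, ← Set.ncard_coe_finset,
    ← Set.ncard_image_of_injective _ Finset.coe_injective, ← h]
  rfl

lemma image_mem_orbSets_conj {α : Type*} [Fintype α] [DecidableEq α] {a b : Equiv.Perm α}
    (τ : Equiv.Perm α) {X : Finset α} (hX : X ∈ orbSets a b) :
    X.image τ ∈ orbSets (τ * a * τ⁻¹) (τ * b * τ⁻¹) := by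
  rw [mem_orbSets] at hX ⊢
  refine ⟨hX.1.image _, fun y hy => ?_, fun Z hZ hne hinv => ?_⟩
  · obtain ⟨x, hx, rfl⟩ := Finset.mem_image.1 hy
    exact ⟨Finset.mem_image.2 ⟨a x, (hX.2.1 x hx).1, by simp⟩,
      Finset.mem_image.2 ⟨b x, (hX.2.1 x hx).2, by simp⟩⟩
  · have h := hX.2.2 (Z.image ⇑τ⁻¹) (fun y hy => ?_) (hne.image _) (fun y hy => ?_)
    · rw [← h, Finset.image_image]
      ext x; simp
    · obtain ⟨z, hz, rfl⟩ := Finset.mem_image.1 hy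
      obtain ⟨x, hx, rfl⟩ := Finset.mem_image.1 (hZ hz)
      simpa using hx
    · obtain ⟨z, hz, rfl⟩ := Finset.mem_image.1 hy
      exact ⟨Finset.mem_image.2 ⟨_, (hinv z hz).1, by simp⟩,
        Finset.mem_image.2 ⟨_, (hinv z hz).2, by simp⟩⟩

lemma smallOrbitCount_conj {n : ℕ} (τ a b : Equiv.Perm (Fin n)) :
    smallOrbitCount (τ * a * τ⁻¹) (τ * b * τ⁻¹) = smallOrbitCount a b := by
  have h : ∀ τ a b : Equiv.Perm (Fin n),
      smallOrbitCount a b ≤ smallOrbitCount (τ * a * τ⁻¹) (τ * b * τ⁻¹) := by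
    intro τ a b
    rw [smallOrbitCount_eq_card, smallOrbitCount_eq_card]
    refine Finset.card_le_card_of_injOn (fun X => X.image τ) (fun X hX => ?_)
      (Finset.image_injective τ.injective).injOn
    rw [Finset.mem_coe, Finset.mem_filter] at hX ⊢
    exact ⟨image_mem_orbSets_conj τ hX.1, by
      rw [Finset.card_image_of_injective _ τ.injective]; exact hX.2⟩
  refine le_antisymm ?_ (h τ a b)
  have := h τ⁻¹ (τ * a * τ⁻¹) (τ * b * τ⁻¹)
  simpa [mul_assoc] using this

end SmallOrbits

section ConjugacyAverage

open scoped Classical in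
lemma card_isConj_mul_sum_conj {H : Type*} [Group H] [Fintype H] (π : H) (f : H → ℝ) :
    ((Finset.univ.filter (IsConj π)).card : ℝ) * ∑ g : H, f (g * π * g⁻¹) =
      Fintype.card H * ∑ σ ∈ Finset.univ.filter (IsConj π), f σ := by
  have hfib : ∀ σ ∈ Finset.univ.filter (IsConj π),
      (Finset.univ.filter fun g : H => g * π * g⁻¹ = σ).card =
      (Finset.univ.filter fun g : H => g * π * g⁻¹ = π).card := by
    intro σ hσ
    obtain ⟨c, rfl⟩ := isConj_iff.1 (Finset.mem_filter.1 hσ).2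
    refine Finset.card_bij' (fun g _ => c⁻¹ * g) (fun g _ => c * g) ?_ ?_ ?_ ?_
    · intro g hg
      simp only [Finset.mem_filter, Finset.mem_univ, true_and] at hg ⊢
      calc c⁻¹ * g * π * (c⁻¹ * g)⁻¹ = c⁻¹ * (g * π * g⁻¹) * c := by group
        _ = π := by rw [hg]; group
    · intro g hg
      simp only [Finset.mem_filter, Finset.mem_univ, true_and] at hg ⊢
      calc c * g * π * (c * g)⁻¹ = c * (g * π * g⁻¹) * c⁻¹ := by group
        _ = _ := by rw [hg]
    · intro g _; simp
    · intro g _; simp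
  set z := (Finset.univ.filter fun g : H => g * π * g⁻¹ = π).card
  have hsum : ∀ f : H → ℝ, ∑ g : H, f (g * π * g⁻¹) =
      z * ∑ σ ∈ Finset.univ.filter (IsConj π), f σ := by
    intro f
    rw [← Finset.sum_fiberwise_of_maps_to (t := Finset.univ.filter (IsConj π))
      (g := fun g : H => g * π * g⁻¹)
      (fun g _ => by simp), Finset.mul_sum]
    refine Finset.sum_congr rfl fun σ hσ => ?_
    rw [← hfib σ hσ, Finset.sum_congr rfl fun g hg => by rw [(Finset.mem_filter.1 hg).2],
      Finset.sum_const, nsmul_eq_mul]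
  have h1 := hsum fun _ => 1
  simp only [Finset.sum_const, Finset.card_univ, nsmul_eq_mul, mul_one] at h1
  rw [hsum, h1]; ring

open scoped Classical in
lemma sum_isConj_div_eq {H : Type*} [Group H] [Fintype H] (π π' : H) {f : H → H → ℝ}
    (hf : ∀ τ a b, f (τ * a * τ⁻¹) (τ * b * τ⁻¹) = f a b) :
    (∑ p : H × H, if IsConj π p.1 ∧ IsConj π' p.2 then f p.1 p.2 else 0) /
      ((Nat.card {σ : H // IsConj π σ} : ℝ) * (Nat.card {σ : H // IsConj π' σ} : ℝ)) =
    (∑ σ : H, f π (σ⁻¹ * π' * σ)) / Fintype.card H := by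
  have hC : ∀ π : H, (0 : ℝ) < (Finset.univ.filter (IsConj π)).card := fun π => by
    exact_mod_cast Finset.card_pos.2 ⟨π, Finset.mem_filter.2 ⟨Finset.mem_univ _, IsConj.refl _⟩⟩
  have hH : (0 : ℝ) < Fintype.card H := by exact_mod_cast Fintype.card_pos
  rw [Nat.card_eq_fintype_card, Nat.card_eq_fintype_card, Fintype.card_subtype,
    Fintype.card_subtype]
  have h1 : (∑ p : H × H, if IsConj π p.1 ∧ IsConj π' p.2 then f p.1 p.2 else 0) =
      ∑ a ∈ Finset.univ.filter (IsConj π), ∑ b ∈ Finset.univ.filter (IsConj π'), f a b := by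
    rw [Fintype.sum_prod_type, Finset.sum_filter]
    refine Finset.sum_congr rfl fun a _ => ?_
    rw [Finset.sum_filter]
    split_ifs with h
    · simp only [h, true_and]
    · simp only [h, false_and, if_false, Finset.sum_const_zero]
  have h2 := card_isConj_mul_sum_conj π
    fun a => ∑ b ∈ Finset.univ.filter (IsConj π'), f a b
  have h3 : ∀ a, ((Finset.univ.filter (IsConj π')).card : ℝ) * ∑ g : H, f a (g * π' * g⁻¹) =
      Fintype.card H * ∑ b ∈ Finset.univ.filter (IsConj π'), f a b :=
    fun a => card_isConj_mul_sum_conj π' (f a)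
  have h4 : ∀ g, ∑ h : H, f (g * π * g⁻¹) (h * π' * h⁻¹) = ∑ σ : H, f π (σ⁻¹ * π' * σ) := by
    intro g
    refine Fintype.sum_equiv ((Equiv.inv H).trans (Equiv.mulRight g)) _ _ fun h => ?_
    rw [← hf g⁻¹]
    congr 1
    · group
    · simp [mul_assoc]
  have h5 : (Fintype.card H : ℝ) * ∑ g : H, ∑ b ∈ Finset.univ.filter (IsConj π'),
      f (g * π * g⁻¹) b = (Finset.univ.filter (IsConj π')).card *
        (Fintype.card H * ∑ σ : H, f π (σ⁻¹ * π' * σ)) := by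
    rw [Finset.mul_sum]
    simp_rw [← h3, h4]
    rw [Finset.sum_const, Finset.card_univ, nsmul_eq_mul]
    ring
  rw [h1, div_eq_div_iff (mul_pos (hC π) (hC π')).ne' hH.ne']
  have h6 : (Fintype.card H : ℝ) * ((∑ a ∈ Finset.univ.filter (IsConj π),
      ∑ b ∈ Finset.univ.filter (IsConj π'), f a b) * Fintype.card H) =
      Fintype.card H * ((∑ σ : H, f π (σ⁻¹ * π' * σ)) *
        ((Finset.univ.filter (IsConj π)).card * (Finset.univ.filter (IsConj π')).card)) := by
    calc _ = (Fintype.card H : ℝ) * (Fintype.card H * (∑ a ∈ Finset.univ.filter (IsConj π),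
          ∑ b ∈ Finset.univ.filter (IsConj π'), f a b)) := by ring
      _ = (Finset.univ.filter (IsConj π)).card * (Fintype.card H *
          ∑ g : H, ∑ b ∈ Finset.univ.filter (IsConj π'), f (g * π * g⁻¹) b) := by
        rw [← h2]; ring
      _ = _ := by rw [h5]; ring
  exact mul_left_cancel₀ hH.ne' h6

lemma expectedSmallOrbits_eq {n : ℕ} (π π' : Equiv.Perm (Fin n)) :
    expectedSmallOrbits n π π' =
      (∑ σ : Equiv.Perm (Fin n), (smallOrbitCount π (σ⁻¹ * π' * σ) : ℝ)) / n.factorial := by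
  classical
  have h := sum_isConj_div_eq π π' (f := fun a b => (smallOrbitCount a b : ℝ))
    fun τ a b => by rw [smallOrbitCount_conj]
  rw [Fintype.card_perm, Fintype.card_fin] at h
  rw [expectedSmallOrbits, ← h]
  congr!

lemma probNoSmallOrbit_eq {n : ℕ} (π π' : Equiv.Perm (Fin n)) :
    probNoSmallOrbit n π π' = ((Finset.univ.filter fun σ : Equiv.Perm (Fin n) =>
      smallOrbitCount π (σ⁻¹ * π' * σ) = 0).card : ℝ) / n.factorial := by
  classical
  have h := sum_isConj_div_eq π π'
    (f := fun a b => if smallOrbitCount a b = 0 then (1 : ℝ) else 0)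
    fun τ a b => by rw [smallOrbitCount_conj]
  rw [Fintype.card_perm, Fintype.card_fin, Finset.sum_boole] at h
  rw [probNoSmallOrbit, ← h, Nat.card_eq_fintype_card, Fintype.card_subtype, Finset.card_filter]
  push_cast
  congr 1
  refine Finset.sum_congr rfl fun p _ => ?_
  rw [← ite_and]
  simp only [and_assoc]

end ConjugacyAverage
section Truncation

variable {n : ℕ} {π π' : Equiv.Perm (Fin n)} {K : ℕ}

lemma smallOrbitCount_eq_add (hK : K ≤ n / 2) (σ : Equiv.Perm (Fin n)) :
    smallOrbitCount π (σ⁻¹ * π' * σ) = (shortOrbits π π' K σ).card +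
      ∑ k ∈ Finset.Ioc K (n / 2),
        ((orbSets π (σ⁻¹ * π' * σ)).filter fun X => X.card = k).card := by
  have h : ∀ m, (shortOrbits π π' m σ).card = ∑ k ∈ Finset.Ioc 0 m,
      ((orbSets π (σ⁻¹ * π' * σ)).filter fun X => X.card = k).card := fun m => by
    have := card_shortOrbits_eq_sum π π' m σ fun _ => True
    simpa [show Finset.Icc 1 m = Finset.Ioc 0 m from rfl] using this
  have h1 : smallOrbitCount π (σ⁻¹ * π' * σ) = (shortOrbits π π' (n / 2) σ).card := by
    rw [smallOrbitCount_eq_card, shortOrbits]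
    congr 1
    refine Finset.filter_congr fun X _ => ?_
    omega
  rw [h1, h, h, Finset.sum_Ioc_consecutive _ (Nat.zero_le K) hK]

lemma binMoment_orbGraphs_one (π π' : Equiv.Perm (Fin n)) (K : ℕ) :
    binMoment (orbGraphs π π' K) 1 =
      (∑ σ : Equiv.Perm (Fin n), ((shortOrbits π π' K σ).card : ℝ)) / n.factorial := by
  simp only [binMoment, Nat.choose_one_right, card_occ_orbGraphs, Fintype.card_fin]

lemma sum_sum_card_orbSets_div_le (π π' : Equiv.Perm (Fin n)) (s : Finset ℕ) :
    (∑ σ : Equiv.Perm (Fin n), ∑ k ∈ s,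
      (((orbSets π (σ⁻¹ * π' * σ)).filter fun X => X.card = k).card : ℝ)) / n.factorial ≤
      ∑ k ∈ s, (invCount π k * invCount π' k : ℝ) / n.choose k := by
  rw [Finset.sum_comm, div_le_iff₀ (by positivity), Finset.sum_mul]
  refine Finset.sum_le_sum fun k _ => ?_
  simpa using sum_card_orbSets_le π π' k

lemma binMoment_orbGraphs_one_le (π π' : Equiv.Perm (Fin n)) (K : ℕ) :
    binMoment (orbGraphs π π' K) 1 ≤
      ∑ k ∈ Finset.Icc 1 K, (invCount π k * invCount π' k : ℝ) / n.choose k := by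
  rw [binMoment_orbGraphs_one]
  refine le_trans (le_of_eq ?_) (sum_sum_card_orbSets_div_le π π' _)
  congr 1
  refine Finset.sum_congr rfl fun σ _ => ?_
  have := card_shortOrbits_eq_sum π π' K σ fun _ => True
  simp only [and_true, Finset.filter_true] at this
  rw [this]
  push_cast
  rfl

lemma expectedSmallOrbits_sub_mem_Icc (hK : K ≤ n / 2) :
    expectedSmallOrbits n π π' - binMoment (orbGraphs π π' K) 1 ∈ Set.Icc 0
      (∑ k ∈ Finset.Ioc K (n / 2), (invCount π k * invCount π' k : ℝ) / n.choose k) := by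
  have h : expectedSmallOrbits n π π' - binMoment (orbGraphs π π' K) 1 =
      (∑ σ : Equiv.Perm (Fin n), ∑ k ∈ Finset.Ioc K (n / 2),
      (((orbSets π (σ⁻¹ * π' * σ)).filter fun X => X.card = k).card : ℝ)) / n.factorial := by
    rw [expectedSmallOrbits_eq, binMoment_orbGraphs_one, ← sub_div, ← Finset.sum_sub_distrib]
    congr 1
    refine Finset.sum_congr rfl fun σ _ => ?_
    rw [smallOrbitCount_eq_add hK]
    push_cast
    ring
  rw [h]
  exact ⟨by positivity, sum_sum_card_orbSets_div_le π π' _⟩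

lemma card_occ_eq_empty_sub_probNoSmallOrbit_mem_Icc (hK : K ≤ n / 2) :
    ((Finset.univ.filter fun σ : Equiv.Perm (Fin n) =>
      occ (orbGraphs π π' K) σ = ∅).card : ℝ) / n.factorial - probNoSmallOrbit n π π' ∈ Set.Icc 0
      (∑ k ∈ Finset.Ioc K (n / 2), (invCount π k * invCount π' k : ℝ) / n.choose k) := by
  have h : ((Finset.univ.filter fun σ : Equiv.Perm (Fin n) =>
      occ (orbGraphs π π' K) σ = ∅).card : ℝ) / n.factorial - probNoSmallOrbit n π π' =
      (∑ σ : Equiv.Perm (Fin n), ((if (shortOrbits π π' K σ).card = 0 then 1 else 0) -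
        (if smallOrbitCount π (σ⁻¹ * π' * σ) = 0 then 1 else 0) : ℝ)) / n.factorial := by
    rw [probNoSmallOrbit_eq, ← sub_div, Finset.sum_sub_distrib, Finset.sum_boole,
      Finset.sum_boole]
    simp only [← Finset.card_eq_zero, card_occ_orbGraphs]
  rw [h]
  constructor
  · refine div_nonneg (Finset.sum_nonneg fun σ _ => ?_) (by positivity)
    rw [smallOrbitCount_eq_add hK]
    split_ifs <;> first | omega | norm_num
  · refine le_trans ?_ (sum_sum_card_orbSets_div_le π π' _)
    gcongr with σ
    rw [smallOrbitCount_eq_add hK]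
    rw [← Nat.cast_sum]
    set t := ∑ k ∈ Finset.Ioc K (n / 2),
        ((orbSets π (σ⁻¹ * π' * σ)).filter fun X => X.card = k).card
    split_ifs with h1 h2 h2
    · simp
    · have : 1 ≤ t := by omega
      simpa using (Nat.one_le_cast (α := ℝ)).2 this
    · omega
    · simp

lemma abs_probNoSmallOrbit_sub_exp_le (hK : K ≤ n / 2) :
    |probNoSmallOrbit n π π' - Real.exp (-expectedSmallOrbits n π π')| ≤
      |((Finset.univ.filter fun σ : Equiv.Perm (Fin n) =>
        occ (orbGraphs π π' K) σ = ∅).card : ℝ) / n.factorial -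
          Real.exp (-binMoment (orbGraphs π π' K) 1)| +
      2 * ∑ k ∈ Finset.Ioc K (n / 2), (invCount π k * invCount π' k : ℝ) / n.choose k := by
  have h1 := expectedSmallOrbits_sub_mem_Icc (π := π) (π' := π') hK
  have h2 := card_occ_eq_empty_sub_probNoSmallOrbit_mem_Icc (π := π) (π' := π') hK
  set E := expectedSmallOrbits n π π'
  set l := binMoment (orbGraphs π π' K) 1 with hl
  set T := ∑ k ∈ Finset.Ioc K (n / 2), (invCount π k * invCount π' k : ℝ) / n.choose k
  set Q := ((Finset.univ.filter fun σ : Equiv.Perm (Fin n) =>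
        occ (orbGraphs π π' K) σ = ∅).card : ℝ) / n.factorial
  have hl0 : 0 ≤ l := by rw [hl, binMoment]; positivity
  have h3 : Real.exp (-E) ≤ Real.exp (-l) := Real.exp_le_exp.2 (by linarith [h1.1])
  have h4 : Real.exp (-l) - Real.exp (-E) ≤ E - l := by
    have e : Real.exp (-E) = Real.exp (-l) * Real.exp (-(E - l)) := by
      rw [← Real.exp_add]; ring_nf
    have h5 := Real.add_one_le_exp (-(E - l))
    have h6 : Real.exp (-l) ≤ 1 := Real.exp_le_one_iff.2 (by linarith)
    have h7 := Real.exp_pos (-l)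
    rw [e]
    nlinarith [mul_le_mul_of_nonneg_left h5 h7.le, mul_le_mul_of_nonneg_right h6 h1.1]
  have h8 := neg_abs_le (Q - Real.exp (-l))
  have h9 := le_abs_self (Q - Real.exp (-l))
  rw [abs_le]
  constructor <;> linarith [h1.1, h1.2, h2.1, h2.2]

end Truncation
section CycleCounts

variable {n : ℕ}

lemma cycleCount_one (π : Equiv.Perm (Fin n)) : cycleCount π 1 = (fixedFinset π).card := by
  rw [cycleCount, if_pos rfl, Nat.card_eq_fintype_card, ← Set.toFinset_card]
  congr 1
  ext x
  simp [fixedFinset, Function.IsFixedPt]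

lemma cycleCount_two (π : Equiv.Perm (Fin n)) : cycleCount π 2 = (twoCycles π).card := by
  rw [cycleCount, if_neg (by norm_num), Equiv.Perm.cycleType_def, Multiset.count_map, twoCycles,
    Finset.card_def, Finset.filter_val]
  congr 1
  refine Multiset.filter_congr fun c _ => ?_
  exact eq_comm

lemma sum_invCountAt_mul_invCount_div_choose_le {M ε : ℝ} (hM : 0 ≤ M) (hε0 : 0 ≤ ε)
    (hε1 : ε ≤ 1) {π π' : Equiv.Perm (Fin n)} {K : ℕ} (hn : 1 ≤ n) (hnε : 1 ≤ ε * √n)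
    (hK : K ≤ n)
    (hprod : ((cycleCount π 1 : ℝ) + √(cycleCount π 2)) *
      (cycleCount π' 1 + √(cycleCount π' 2)) ≤ M * n)
    (ha : (cycleCount π 1 : ℝ) ≤ ε * n) (ha' : (cycleCount π' 1 : ℝ) ≤ ε * n)
    (ha3 : (cycleCount π 1 : ℝ) ^ 3 ≤ (n : ℝ) ^ 2)
    (ha3' : (cycleCount π' 1 : ℝ) ^ 3 ≤ (n : ℝ) ^ 2) (v : Fin n) :
    ∑ k ∈ Finset.Icc 1 K, (invCountAt π v k * invCount π' k : ℝ) / n.choose k ≤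
      ε * (Real.exp (M + M ^ 2 + 2) ^ 2 *
        ∑ k ∈ Finset.Icc 1 K, Real.exp 1 * k * (k : ℝ) ^ k) := by
  rw [cycleCount_one, cycleCount_two, cycleCount_one, cycleCount_two] at hprod
  rw [cycleCount_one] at ha ha' ha3 ha3'
  obtain ⟨x, y, hx, hy, hxε, hyε, hxy, hcx, hcy⟩ := exists_cycleGen_le hM hε1 hn hnε
    (by simpa using card_fixedFinset_add_le π) (by simpa using card_fixedFinset_add_le π')
    hprod ha ha' ha3 ha3'
  set B := Real.exp (M + M ^ 2 + 2)
  have hB : 0 < B := Real.exp_pos _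
  rw [← mul_assoc, Finset.mul_sum]
  refine Finset.sum_le_sum fun k hk => ?_
  rw [Finset.mem_Icc] at hk
  have hch : (0 : ℝ) < n.choose k := by exact_mod_cast Nat.choose_pos (hk.2.trans hK)
  rw [div_le_iff₀ hch]
  have h1 : (invCountAt π v k : ℝ) * x ^ k ≤ ε * B :=
    (invCountAt_mul_pow_le π v k hx.le (hxε.trans hε1)).trans
      (mul_le_mul hxε hcx (cycleGen_nonneg _ _ _ hx.le) hε0)
  have h2 : (invCount π' k : ℝ) * y ^ k ≤ B :=
    (invCount_mul_pow_le π' k hy.le (hyε.trans hε1)).trans hcy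
  calc (invCountAt π v k * invCount π' k : ℝ)
      = (invCountAt π v k * x ^ k) * (invCount π' k * y ^ k) * (n : ℝ) ^ k := by
        rw [show (invCountAt π v k * x ^ k) * (invCount π' k * y ^ k) * (n : ℝ) ^ k =
          invCountAt π v k * invCount π' k * (x * y * n) ^ k by ring, hxy, one_pow, mul_one]
    _ ≤ (ε * B) * B * (Real.exp 1 * k * (k : ℝ) ^ k * n.choose k) := by
        gcongr
        exact pow_le_choose hk.1 (hk.2.trans hK)
    _ = ε * B ^ 2 * (Real.exp 1 * k * (k : ℝ) ^ k) * n.choose k := by ring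

end CycleCounts

section Limits

variable {π π' : (n : ℕ) → Equiv.Perm (Fin n)} {M : ℝ}

lemma eventually_pow_three_le {u : ℕ → ℝ} (hu : ∀ n, 0 ≤ u n)
    (h : u =o[atTop] fun n : ℕ => (n : ℝ) ^ ((2 : ℝ) / 3)) {ε : ℝ} (hε : 0 < ε) :
    ∀ᶠ n in atTop, u n ^ 3 ≤ ε * (n : ℝ) ^ 2 := by
  have hδ : 0 < min ε 1 := lt_min hε one_pos
  filter_upwards [h.def hδ] with n hn
  rw [Real.norm_of_nonneg (hu n), Real.norm_of_nonneg (by positivity)] at hn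
  have hp : ((n : ℝ) ^ ((2 : ℝ) / 3)) ^ 3 = (n : ℝ) ^ 2 := by
    rw [← Real.rpow_natCast, ← Real.rpow_mul (by positivity), ← Real.rpow_natCast]
    norm_num
  calc u n ^ 3 ≤ (min ε 1 * (n : ℝ) ^ ((2 : ℝ) / 3)) ^ 3 := pow_le_pow_left₀ (hu n) hn 3
    _ = min ε 1 ^ 3 * (n : ℝ) ^ 2 := by rw [mul_pow, hp]
    _ ≤ ε * (n : ℝ) ^ 2 := by
        gcongr
        exact (pow_le_of_le_one hδ.le (min_le_right _ _) (by norm_num)).trans (min_le_left _ _)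

lemma eventually_le_mul {u : ℕ → ℝ}
    (h : ∀ ε : ℝ, 0 < ε → ∀ᶠ n : ℕ in atTop, u n ^ 3 ≤ ε * (n : ℝ) ^ 2) {ε : ℝ} (hε : 0 < ε) :
    ∀ᶠ n : ℕ in atTop, u n ≤ ε * n := by
  filter_upwards [h (ε ^ 3) (by positivity), eventually_ge_atTop 1] with n hn hn1
  have h1 : (1 : ℝ) ≤ n := by exact_mod_cast hn1
  refine le_of_pow_le_pow_left₀ (n := 3) (by norm_num) (by positivity) (hn.trans ?_)
  rw [mul_pow]
  gcongr
  norm_num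

lemma tendsto_iSup_sum_invCountAt (hM : 0 ≤ M) (K : ℕ)
    (hc : ∀ ε : ℝ, 0 < ε → ∀ᶠ n : ℕ in atTop, (cycleCount (π n) 1 : ℝ) ^ 3 ≤ ε * (n : ℝ) ^ 2)
    (hc' : ∀ ε : ℝ, 0 < ε → ∀ᶠ n : ℕ in atTop, (cycleCount (π' n) 1 : ℝ) ^ 3 ≤ ε * (n : ℝ) ^ 2)
    (hprod : ∀ᶠ n : ℕ in atTop, ((cycleCount (π n) 1 : ℝ) + √(cycleCount (π n) 2)) *
      (cycleCount (π' n) 1 + √(cycleCount (π' n) 2)) ≤ M * n) :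
    Tendsto (fun n => ⨆ v, ∑ k ∈ Finset.Icc 1 K,
      (invCountAt (π n) v k * invCount (π' n) k : ℝ) / n.choose k) atTop (nhds 0) := by
  set D := Real.exp (M + M ^ 2 + 2) ^ 2 * ∑ k ∈ Finset.Icc 1 K, Real.exp 1 * k * (k : ℝ) ^ k
    with hD
  have hD0 : 0 ≤ D := by positivity
  rw [Metric.tendsto_nhds]
  intro η hη
  set ε := min (η / (D + 1) / 2) 1 with hεdef
  have hε : 0 < ε := by positivity
  have hεη : ε * D < η := by
    calc ε * D ≤ η / (D + 1) / 2 * (D + 1) := by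
          gcongr
          · exact min_le_left _ _
          · linarith
      _ = η / 2 := by field_simp
      _ < η := half_lt_self hη
  have hsqrt : ∀ᶠ n : ℕ in atTop, 1 ≤ ε * √(n : ℝ) :=
    ((Real.tendsto_sqrt_atTop.comp tendsto_natCast_atTop_atTop).const_mul_atTop
      hε).eventually_ge_atTop 1
  filter_upwards [hprod, hc 1 one_pos, hc' 1 one_pos, hsqrt, eventually_ge_atTop (max 1 K),
    eventually_le_mul hc hε,
    eventually_le_mul hc' hε] with n hn h3 h3' hs hnK ha ha'
  rw [one_mul] at h3 h3'
  rw [Real.dist_0_eq_abs, abs_of_nonneg (Real.iSup_nonneg fun v => by positivity)]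
  refine lt_of_le_of_lt (Real.iSup_le (fun v => ?_) (mul_nonneg hε.le hD0)) hεη
  exact sum_invCountAt_mul_invCount_div_choose_le hM hε.le (min_le_right _ _)
    ((le_max_left _ _).trans hnK) hs ((le_max_right _ _).trans hnK) hn ha ha' h3 h3' v

lemma tendsto_prob_occ_orbGraphs_sub_exp (hM : 0 ≤ M) (K : ℕ) {L : ℝ}
    (hc : ∀ ε : ℝ, 0 < ε → ∀ᶠ n : ℕ in atTop, (cycleCount (π n) 1 : ℝ) ^ 3 ≤ ε * (n : ℝ) ^ 2)
    (hc' : ∀ ε : ℝ, 0 < ε → ∀ᶠ n : ℕ in atTop, (cycleCount (π' n) 1 : ℝ) ^ 3 ≤ ε * (n : ℝ) ^ 2)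
    (hprod : ∀ᶠ n : ℕ in atTop, ((cycleCount (π n) 1 : ℝ) + √(cycleCount (π n) 2)) *
      (cycleCount (π' n) 1 + √(cycleCount (π' n) 2)) ≤ M * n)
    (hL : ∀ᶠ n in atTop, binMoment (orbGraphs (π n) (π' n) K) 1 ≤ L) :
    Tendsto (fun n => ((Finset.univ.filter fun σ : Equiv.Perm (Fin n) =>
      occ (orbGraphs (π n) (π' n) K) σ = ∅).card : ℝ) / n.factorial -
        Real.exp (-binMoment (orbGraphs (π n) (π' n) K) 1)) atTop (nhds 0) := by
  set w : ℕ → ℝ := fun n => ⨆ v, ∑ k ∈ Finset.Icc 1 K,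
    (invCountAt (π n) v k * invCount (π' n) k : ℝ) / n.choose k with hw
  set w' : ℕ → ℝ := fun n => ⨆ v, ∑ k ∈ Finset.Icc 1 K,
    (invCountAt (π' n) v k * invCount (π n) k : ℝ) / n.choose k with hw'
  have hw0 : ∀ n, 0 ≤ w n := fun n => Real.iSup_nonneg fun v => by positivity
  have hw0' : ∀ n, 0 ≤ w' n := fun n => Real.iSup_nonneg fun v => by positivity
  have h := tendsto_iSup_sum_invCountAt hM K hc hc' hprod
  have h' := tendsto_iSup_sum_invCountAt hM K hc' hc (by simpa only [mul_comm] using hprod)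
  refine tendsto_prob_occ_eq_empty_sub_exp (K := K) (w := fun n => w n + w' n) (L := L)
    (Eventually.of_forall fun n => sparseFamily_orbGraphs (fun v => ?_) (fun v => ?_))
    (fun n => add_nonneg (hw0 n) (hw0' n)) (by simpa using h.add h') hL
  · rw [Fintype.card_fin]
    exact (le_ciSup (f := fun v => ∑ k ∈ Finset.Icc 1 K,
      (invCountAt (π n) v k * invCount (π' n) k : ℝ) / n.choose k)
      (Set.finite_range _).bddAbove v).trans (le_add_of_nonneg_right (hw0' n))
  · rw [Fintype.card_fin]
    simp_rw [mul_comm (invCount (π n) _ : ℝ)]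
    exact (le_ciSup (f := fun v => ∑ k ∈ Finset.Icc 1 K,
      (invCountAt (π' n) v k * invCount (π n) k : ℝ) / n.choose k)
      (Set.finite_range _).bddAbove v).trans (le_add_of_nonneg_left (hw0 n))

lemma cycleCount_two_add_div_le_one {n : ℕ} (π π' : Equiv.Perm (Fin n)) :
    ((cycleCount π 2 : ℝ) + cycleCount π' 2) / n ≤ 1 := by
  refine div_le_one_of_le₀ ?_ (by positivity)
  rw [cycleCount_two, cycleCount_two]
  have h := card_fixedFinset_add_le π
  have h' := card_fixedFinset_add_le π'
  rw [Fintype.card_fin] at h h'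
  have : (twoCycles π).card + (twoCycles π').card ≤ n := by omega
  exact_mod_cast this

lemma exists_invCount_mul_invCount_div_choose_le (hM : 0 ≤ M)
    (hc : ∀ ε : ℝ, 0 < ε → ∀ᶠ n : ℕ in atTop, (cycleCount (π n) 1 : ℝ) ^ 3 ≤ ε * (n : ℝ) ^ 2)
    (hc' : ∀ ε : ℝ, 0 < ε → ∀ᶠ n : ℕ in atTop, (cycleCount (π' n) 1 : ℝ) ^ 3 ≤ ε * (n : ℝ) ^ 2)
    (hprod : ∀ᶠ n : ℕ in atTop, ((cycleCount (π n) 1 : ℝ) + √(cycleCount (π n) 2)) *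
      (cycleCount (π' n) 1 + √(cycleCount (π' n) 2)) ≤ M * n)
    (htwo : limsup (fun n => ((cycleCount (π n) 2 : ℝ) + (cycleCount (π' n) 2 : ℝ)) / n) atTop
      < 1) :
    ∃ C c : ℝ, 0 < C ∧ 0 < c ∧ ∀ᶠ n : ℕ in atTop, ∀ k : ℕ, 1 ≤ k → 2 * k ≤ n →
      (invCount (π n) k * invCount (π' n) k : ℝ) / n.choose k ≤
        C * (k * Real.exp (-(c * k))) := by
  obtain ⟨t, ht, ht1⟩ := exists_between htwo
  obtain ⟨C, c, ε, hC, hc0, hε, key⟩ := exists_mul_le_choose (sub_pos.2 ht1) hM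
  refine ⟨C, c, hC, hc0, ?_⟩
  have hbdd := isBoundedUnder_of (f := atTop) ⟨1, fun n : ℕ =>
    cycleCount_two_add_div_le_one (π n) (π' n)⟩
  filter_upwards [hprod, hc ε hε, hc' ε hε, eventually_lt_of_limsup_lt ht hbdd,
    eventually_gt_atTop 0] with n hn h3 h3' hb hn0 k hk hkn
  have hch : (0 : ℝ) < n.choose k := by exact_mod_cast Nat.choose_pos (by omega)
  rw [div_le_iff₀ hch]
  rw [div_lt_iff₀ (by exact_mod_cast hn0)] at hb
  simp only [cycleCount_one, cycleCount_two] at hn h3 h3' hb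
  exact key n k _ _ _ _ _ _ _ _ (by positivity) (by positivity) hk hkn
    (by simpa using card_fixedFinset_add_le (π n)) (by simpa using card_fixedFinset_add_le (π' n))
    hn h3 h3' (by linarith)
    (fun x hx hx1 => invCount_mul_pow_le (π n) k hx.le hx1)
    (fun x hx hx1 => invCount_mul_pow_le (π' n) k hx.le hx1)

end Limits

/-- Poisson approximation: under the stated hypotheses,
`P(Nₙ = 0) − exp(−E[Nₙ]) → 0` as `n → ∞`. -/
theorem poisson_approximation_no_small_orbit
    (π π' : (n : ℕ) → Equiv.Perm (Fin n))
    (h1 : (fun n => (cycleCount (π n) 1 : ℝ) + (cycleCount (π' n) 1 : ℝ)) =o[atTop]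
        fun n => (n : ℝ) ^ ((2 : ℝ) / 3))
    (h2 : (fun n => ((cycleCount (π n) 1 : ℝ) + Real.sqrt (cycleCount (π n) 2)) *
        ((cycleCount (π' n) 1 : ℝ) + Real.sqrt (cycleCount (π' n) 2))) =O[atTop]
        fun n => (n : ℝ))
    (h3 : limsup (fun n => ((cycleCount (π n) 2 : ℝ) + (cycleCount (π' n) 2 : ℝ)) / n) atTop
        < 1) :
    Tendsto
      (fun n => probNoSmallOrbit n (π n) (π' n) -
        Real.exp (-expectedSmallOrbits n (π n) (π' n)))
      atTop (nhds 0) := by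
  have hc : ∀ ε : ℝ, 0 < ε → ∀ᶠ n : ℕ in atTop,
      (cycleCount (π n) 1 : ℝ) ^ 3 ≤ ε * (n : ℝ) ^ 2 := fun ε hε => by
    filter_upwards [eventually_pow_three_le (fun n => by positivity) h1 hε] with n hn
    exact le_trans (by gcongr; exact le_add_of_nonneg_right (by positivity)) hn
  have hc' : ∀ ε : ℝ, 0 < ε → ∀ᶠ n : ℕ in atTop,
      (cycleCount (π' n) 1 : ℝ) ^ 3 ≤ ε * (n : ℝ) ^ 2 := fun ε hε => by
    filter_upwards [eventually_pow_three_le (fun n => by positivity) h1 hε] with n hn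
    exact le_trans (by gcongr; exact le_add_of_nonneg_left (by positivity)) hn
  obtain ⟨M, hM, hbound⟩ := h2.exists_nonneg
  have hprod : ∀ᶠ n : ℕ in atTop, ((cycleCount (π n) 1 : ℝ) + √(cycleCount (π n) 2)) *
      (cycleCount (π' n) 1 + √(cycleCount (π' n) 2)) ≤ M * n := by
    filter_upwards [hbound.bound] with n hn
    rwa [Real.norm_of_nonneg (by positivity), Real.norm_of_nonneg (by positivity)] at hn
  obtain ⟨C, c, hC, hc0, hI⟩ := exists_invCount_mul_invCount_div_choose_le hM hc hc' hprod h3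
  set s : ℕ → ℝ := fun k => C * (k * Real.exp (-(c * k))) with hs
  have hs0 : ∀ k, 0 ≤ s k := fun k => by positivity
  have hsum : Summable s := by
    have := (Real.summable_pow_mul_exp_neg_nat_mul 1 hc0).mul_left C
    simpa [hs] using this
  rw [Metric.tendsto_nhds]
  intro η hη
  obtain ⟨K, hK⟩ : ∃ K, ∑' k, s k - η / 4 < ∑ k ∈ Finset.range (K + 1), s k := by
    have := (hsum.hasSum.tendsto_sum_nat.comp (tendsto_add_atTop_nat 1)).eventually
      (lt_mem_nhds (show ∑' k, s k - η / 4 < ∑' k, s k by linarith))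
    exact this.exists
  have htail : ∀ m, ∑ k ∈ Finset.Ioc K m, s k < η / 4 := fun m => by
    have hdisj : Disjoint (Finset.range (K + 1)) (Finset.Ioc K m) := by
      rw [Finset.disjoint_left]
      intro k hk hk'
      rw [Finset.mem_range] at hk
      rw [Finset.mem_Ioc] at hk'
      omega
    have := hsum.sum_le_tsum (Finset.range (K + 1) ∪ Finset.Ioc K m) fun k _ => hs0 k
    rw [Finset.sum_union hdisj] at this
    linarith
  have hL : ∀ᶠ n in atTop, binMoment (orbGraphs (π n) (π' n) K) 1 ≤ ∑' k, s k := by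
    filter_upwards [hI, eventually_ge_atTop (2 * K)] with n hn hnK
    refine (binMoment_orbGraphs_one_le _ _ _).trans
      ((Finset.sum_le_sum fun k hk => ?_).trans (hsum.sum_le_tsum (Finset.Icc 1 K) fun k _ => hs0 k))
    rw [Finset.mem_Icc] at hk
    exact hn k hk.1 (by omega)
  have hocc := Metric.tendsto_nhds.1
    (tendsto_prob_occ_orbGraphs_sub_exp hM K hc hc' hprod hL) (η / 2) (half_pos hη)
  filter_upwards [hocc, hI, eventually_ge_atTop (2 * K)] with n hn hIn hnK
  rw [Real.dist_0_eq_abs] at hn ⊢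
  have hT : ∑ k ∈ Finset.Ioc K (n / 2),
      (invCount (π n) k * invCount (π' n) k : ℝ) / n.choose k ≤
        ∑ k ∈ Finset.Ioc K (n / 2), s k := by
    refine Finset.sum_le_sum fun k hk => ?_
    rw [Finset.mem_Ioc] at hk
    exact hIn k (by omega) (by omega)
  have h5 := abs_probNoSmallOrbit_sub_exp_le (π := π n) (π' := π' n) (K := K) (by omega)
  linarith [htail (n / 2)]
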